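/- Let Γ be a connected metric graph with a fixed self-loop-free model (V,E) and let D ∈ |D_0| be a generic divisor with connected components C_1, …, C_n of Γ∖supp(D_E). Then dim Δ_D = deg D − g(Γ) + Σ_{i=1}^n (g(C_i) − deg D|_{C_i}). -/

import Mathlib

open scoped ENNReal
open Set Function

namespace TropGraph

variable {G : Type*} [MetricSpace G]

/-! ### Metric graphs: length spaces with star-shaped neighbourhoods -/

/-- The length of a path, via the extended variation of its extension to `ℝ`. -/
noncomputable def pathLength {x y : G} (g : Path x y) : ℝ≥0∞ :=
  eVariationOn (fun t : ℝ => g.extend t) (Set.Icc 0 1)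

/-- The star with `v` branches of radius `ε`: a disjoint union of `v` copies of `[0, ε)`
with all the zeroes identified. -/
def starSetoid (v : ℕ) (ε : ℝ) : Setoid (Fin v × Set.Ico (0:ℝ) ε) where
  r a b := a = b ∨ ((a.2 : ℝ) = 0 ∧ (b.2 : ℝ) = 0)
  iseqv :=
    { refl := fun _ => Or.inl rfl
      symm := fun h => h.imp Eq.symm And.symm
      trans := fun h₁ h₂ => by
        rcases h₁ with rfl | h₁
        · exact h₂
        · rcases h₂ with rfl | h₂
          · exact Or.inr h₁
          · exact Or.inr ⟨h₁.1, h₂.2⟩ }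

/-- The glued star-shaped space `⊔_{i=1}^v [0, ε) / ∼`. -/
def StarGlue (v : ℕ) (ε : ℝ) : Type :=
  Quotient (starSetoid v ε)

instance (v : ℕ) (ε : ℝ) : TopologicalSpace (StarGlue v ε) := by
  unfold StarGlue; infer_instance

/-- `U` is a star-shaped neighbourhood of `x` of valence `v`. -/
def IsStarNbhdOf (x : G) (v : ℕ) (U : Set G) : Prop :=
  ∃ (ε : ℝ) (hε : 0 < ε) (φ : U ≃ₜ StarGlue v ε) (hx : x ∈ U),
    ∀ i : Fin v, φ ⟨x, hx⟩ = Quotient.mk (starSetoid v ε) (i, ⟨0, le_rfl, hε⟩)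

/-- A metric graph: a compact length space in which every point has a star-shaped
neighbourhood. -/
def IsMetricGraph (X : Type*) [MetricSpace X] : Prop :=
  CompactSpace X ∧
  (∀ x y : X, edist x y = ⨅ g : Path x y, pathLength g) ∧
  ∀ x : X, ∃ (v : ℕ) (U : Set X), U ∈ nhds x ∧ IsStarNbhdOf x v U

/-- `x` has valence `v`. -/
def HasValence (x : G) (v : ℕ) : Prop :=
  ∃ U ∈ nhds x, IsStarNbhdOf x v U

/-! ### Rational functions, tangent directions, orders and divisors -/

/-- `g` is a unit speed (isometric) path of length `ε` starting at `x`. -/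
def IsUnitSpeedFrom (x : G) (ε : ℝ) (g : ℝ → G) : Prop :=
  g 0 = x ∧ ∀ s ∈ Set.Ico (0:ℝ) ε, ∀ t ∈ Set.Ico (0:ℝ) ε, dist (g s) (g t) = |s - t|

/-- `f` has (integer) slope `s` along the path `g` near its starting point. -/
def HasSlopeAlong (f : G → ℝ) (g : ℝ → G) (s : ℤ) : Prop :=
  ∃ δ > (0:ℝ), ∀ t ∈ Set.Ico (0:ℝ) δ, f (g t) = f (g 0) + s * t

/-- A rational function: continuous, and linear with integer slope along every direction
near every point.  (On a compact metric graph this coincides with being continuous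
piecewise linear with integer slopes.) -/
def IsRational (f : G → ℝ) : Prop :=
  Continuous f ∧ ∀ (x : G) (ε : ℝ) (g : ℝ → G), 0 < ε → IsUnitSpeedFrom x ε g →
    ∃ s : ℤ, HasSlopeAlong f g s

/-- Unit speed paths emanating from `x`. -/
def UnitPath (x : G) : Type _ :=
  {g : ℝ → G // ∃ ε > (0:ℝ), IsUnitSpeedFrom x ε g}

/-- Two unit speed paths are equivalent when they agree near `0`. -/
def germSetoid (x : G) : Setoid (UnitPath x) where
  r g₁ g₂ := ∃ δ > (0:ℝ), ∀ t ∈ Set.Ico (0:ℝ) δ, g₁.1 t = g₂.1 t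
  iseqv := by
    constructor
    · intro g
      obtain ⟨ε, hε, _⟩ := g.2
      exact ⟨ε, hε, fun t _ => rfl⟩
    · rintro g₁ g₂ ⟨δ, hδ, h⟩
      exact ⟨δ, hδ, fun t ht => (h t ht).symm⟩
    · rintro g₁ g₂ g₃ ⟨δ₁, hδ₁, h₁⟩ ⟨δ₂, hδ₂, h₂⟩
      refine ⟨min δ₁ δ₂, lt_min hδ₁ hδ₂, fun t ht => ?_⟩
      have ht' := Set.mem_Ico.mp ht
      rw [h₁ t (Set.mem_Ico.mpr ⟨ht'.1, lt_of_lt_of_le ht'.2 (min_le_left _ _)⟩),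
        h₂ t (Set.mem_Ico.mpr ⟨ht'.1, lt_of_lt_of_le ht'.2 (min_le_right _ _)⟩)]

/-- The set of (unit) tangent directions at `x`: germs of unit speed paths from `x`. -/
def TangentDir (x : G) : Type _ :=
  Quotient (germSetoid x)

open scoped Classical in
/-- The outgoing slope of `f` along a tangent direction. -/
noncomputable def tangentSlope (f : G → ℝ) {x : G} (ζ : TangentDir x) : ℤ :=
  if h : ∃ s : ℤ, HasSlopeAlong f (Quotient.out ζ).1 s then h.choose else 0

/-- The order of `f` at `x`: the sum of the outgoing slopes of `f` at `x`. -/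
noncomputable def ordAt (f : G → ℝ) (x : G) : ℤ :=
  ∑ᶠ ζ : TangentDir x, tangentSlope f ζ

/-- Divisors are represented as finitely supported functions `G → ℤ`. -/
def FinSupp (D : G → ℤ) : Prop :=
  (Function.support D).Finite

/-- A divisor is effective when all its coefficients are nonnegative. -/
def Effective (D : G → ℤ) : Prop :=
  ∀ x, 0 ≤ D x

/-- The degree of a divisor. -/
noncomputable def deg (D : G → ℤ) : ℤ :=
  ∑ᶠ x, D x

/-- The degree of the restriction of a divisor to a subset. -/
noncomputable def degOn (S : Set G) (D : G → ℤ) : ℤ :=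
  ∑ᶠ x ∈ S, D x

/-- Linear equivalence of divisors: the difference is the divisor of a rational function. -/
def LinEquiv (D D' : G → ℤ) : Prop :=
  ∃ f : G → ℝ, IsRational f ∧ ∀ x, D' x = D x + ordAt f x

/-- `R(D)`: rational functions `f` with `D + div f ≥ 0`. -/
def RD (D : G → ℤ) : Set (G → ℝ) :=
  {f | IsRational f ∧ ∀ x, 0 ≤ D x + ordAt f x}

/-- The complete linear system `|D₀|` of effective divisors linearly equivalent to `D₀`. -/
def LinSys (D₀ : G → ℤ) : Set (G → ℤ) :=
  {D | FinSupp D ∧ Effective D ∧ LinEquiv D₀ D}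

/-- The oscillation `max f - min f` of a function. -/
noncomputable def osc (f : G → ℝ) : ℝ :=
  sSup (Set.range f) - sInf (Set.range f)

/-- The distance `d_∞` on a complete linear system. -/
noncomputable def linDist (D₁ D₂ : G → ℤ) : ℝ :=
  sInf {r : ℝ | ∃ f : G → ℝ, IsRational f ∧ (∀ x, D₂ x = D₁ x + ordAt f x) ∧ r = osc f}

/-- `f` is constant on `S`. -/
def ConstOn (f : G → ℝ) (S : Set G) : Prop :=
  ∀ x ∈ S, ∀ y ∈ S, f x = f y

/-! ### Subgraphs, arcs, components, firing -/

/-- An open arc: the isometric image of a nonempty open interval. -/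
def IsOpenArc (S : Set G) : Prop :=
  ∃ (a b : ℝ) (g : ℝ → G), a < b ∧
    (∀ s ∈ Set.Ioo a b, ∀ t ∈ Set.Ioo a b, dist (g s) (g t) = |s - t|) ∧
    S = g '' Set.Ioo a b

/-- The set of connected components of a subset. -/
def compsOf (S : Set G) : Set (Set G) :=
  {C | ∃ x ∈ S, C = connectedComponentIn S x}

/-- The outgoing degree of `x` with respect to a closed subgraph `Z`:
the number of tangent directions at `x` leaving `Z`. -/
noncomputable def degOut (Z : Set G) (x : G) : ℕ :=
  Nat.card {ζ : TangentDir x //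
    ∃ δ > (0:ℝ), ∀ t ∈ Set.Ioo (0:ℝ) δ, (Quotient.out ζ).1 t ∉ interior Z}

/-- A closed subgraph `Z` can fire with respect to `D` when `D(x) ≥ deg^out_Z(x)` for
all `x` on the boundary of `Z`. -/
def CanFire (D : G → ℤ) (Z : Set G) : Prop :=
  Z.Nonempty ∧ IsClosed Z ∧ (compsOf Z).Finite ∧
  ∀ x ∈ frontier Z, (degOut Z x : ℤ) ≤ D x

/-- A `v`-reduced divisor. -/
def IsReduced (v : G) (D : G → ℤ) : Prop :=
  (∀ x, x ≠ v → 0 ≤ D x) ∧ ∀ Z : Set G, v ∉ Z → ¬CanFire D Z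

/-- `D` is `V`-unsaturated: no closed subgraph whose boundary meets `V` can fire. -/
def Unsaturated (V : Set G) (D : G → ℤ) : Prop :=
  ¬∃ Z : Set G, (frontier Z ∩ V).Nonempty ∧ CanFire D Z

/-- A local maximum of `f`: a closed connected set on which `f` is constant, with a
neighbourhood on which `f` is strictly smaller outside of it. -/
def IsLocalMaxSet (f : G → ℝ) (C : Set G) : Prop :=
  IsClosed C ∧ IsConnected C ∧ ConstOn f C ∧
  ∃ U, IsOpen U ∧ C ⊆ U ∧ ∀ x ∈ U \ C, ∀ y ∈ C, f x < f y

/-! ### Models and genus -/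

/-- A model of the metric graph: a finite set of vertices whose complement is a finite
disjoint union of open arcs. -/
def IsGraphModel (V : Set G) : Prop :=
  V.Finite ∧ (compsOf Vᶜ).Finite ∧ ∀ C ∈ compsOf Vᶜ, IsOpenArc C

/-- A model has no self-loops: the closure of each open edge contains two distinct
endpoints. -/
def LoopFree (V : Set G) : Prop :=
  ∀ C ∈ compsOf Vᶜ, (closure C \ C).ncard = 2

/-- A model of an open subgraph `U`, together with valences of its vertices inside `U`. -/
def IsModelIn (U V : Set G) (val : G → ℕ) : Prop :=
  V ⊆ U ∧ V.Finite ∧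
  (∀ x ∈ V, ∃ W ∈ nhds x, W ⊆ U ∧ IsStarNbhdOf x (val x) W) ∧
  (compsOf (U \ V)).Finite ∧ (∀ C ∈ compsOf (U \ V), IsOpenArc C) ∧
  (compsOf U).Finite

/-- The genus (first Betti number) of an open subgraph `U`, i.e. of its completion:
computed from any model as `Σ val(x) - #edges - #vertices + #components`. -/
def HasGenusOpen (U : Set G) (g : ℤ) : Prop :=
  ∃ (V : Set G) (val : G → ℕ), IsModelIn U V val ∧
    g = (∑ᶠ x ∈ V, (val x : ℤ)) - ((compsOf (U \ V)).ncard : ℤ)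
        - (V.ncard : ℤ) + ((compsOf U).ncard : ℤ)

/-! ### Chip firing moves -/

/-- The open `ε`-neighbourhood of `Z`. -/
def ZNbhd (Z : Set G) (ε : ℝ) : Set G :=
  {x | Metric.infDist x Z < ε}

/-- The chip firing function `CF(Z, ε)`. -/
noncomputable def CF (Z : Set G) (ε : ℝ) : G → ℝ :=
  fun x => -min (Metric.infDist x Z) ε

/-- The data of a chip firing move: a closed subgraph with finitely many components such
that `Z_ε \ Z` is a disjoint union of open intervals. -/
def ChipData (Z : Set G) (ε : ℝ) : Prop :=
  IsClosed Z ∧ Z.Nonempty ∧ (compsOf Z).Finite ∧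
  ∀ C ∈ compsOf (ZNbhd Z ε \ Z), IsOpenArc C

/-- `h` is a chip firing move. -/
def IsCFMove (h : G → ℝ) : Prop :=
  ∃ (Z : Set G) (ε : ℝ), 0 < ε ∧ ChipData Z ε ∧ h = CF Z ε

/-- `f` is linear (with some real slope) on the open arc `C`. -/
def LinearOnArc (f : G → ℝ) (C : Set G) : Prop :=
  ∃ (a b : ℝ) (g : ℝ → G) (s c : ℝ), a < b ∧
    (∀ u ∈ Set.Ioo a b, ∀ t ∈ Set.Ioo a b, dist (g u) (g t) = |u - t|) ∧
    C = g '' Set.Ioo a b ∧ ∀ t ∈ Set.Ioo a b, f (g t) = s * t + c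

/-- A weighted chip firing move. -/
def IsWeightedCF (f : G → ℝ) : Prop :=
  IsRational f ∧ (¬∀ x y : G, f x = f y) ∧
  ∃ Z₁ Z₂ : Set G, IsClosed Z₁ ∧ IsClosed Z₂ ∧ Z₁.Nonempty ∧ Z₂.Nonempty ∧
    Disjoint Z₁ Z₂ ∧ Z₁ ≠ Set.univ ∧ Z₂ ≠ Set.univ ∧
    (∀ C ∈ compsOf (Z₁ ∪ Z₂)ᶜ, IsOpenArc C) ∧
    ConstOn f Z₁ ∧ ConstOn f Z₂ ∧
    ∀ C ∈ compsOf (Z₁ ∪ Z₂)ᶜ, LinearOnArc f C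

/-! ### Cells of the complete linear system -/

/-- The part of the support of a divisor lying in the interiors of the edges. -/
def edgeSupp (V : Set G) (D : G → ℤ) : Set G :=
  {x | x ∉ V ∧ D x ≠ 0}

/-- The dimension of the cell of `|D₀|` containing `D` in its relative interior:
the number of connected components of `Γ ∖ supp D_E`, minus one. -/
noncomputable def cellDim (V : Set G) (D : G → ℤ) : ℤ :=
  ((compsOf (edgeSupp V D)ᶜ).ncard : ℤ) - 1

/-- Two divisors of `|D₀|` have the same combinatorial type with respect to the model `V`
(they lie in the relative interior of the same cell): equal multiplicities on the
vertices, chip configurations on the edges related by a homeomorphism fixing the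
vertices and each edge, and equal slopes at all tangent directions at the vertices. -/
def SameType (V : Set G) (D₀ D₁ D₂ : G → ℤ) : Prop :=
  (∀ v ∈ V, D₁ v = D₂ v) ∧
  (∃ h : G ≃ₜ G, (∀ v ∈ V, h v = v) ∧ (∀ x ∉ V, h x ∈ connectedComponentIn Vᶜ x) ∧
    ∀ x, D₂ (h x) = D₁ x) ∧
  (∃ f₁ f₂ : G → ℝ, IsRational f₁ ∧ IsRational f₂ ∧
    (∀ x, D₁ x = D₀ x + ordAt f₁ x) ∧ (∀ x, D₂ x = D₀ x + ordAt f₂ x) ∧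
    ∀ v ∈ V, ∀ ζ : TangentDir v, tangentSlope f₁ ζ = tangentSlope f₂ ζ)

/-- `D'` lies in the closed cell `Δ_D` of `|D₀|`. -/
def InClosedCell (V : Set G) (D₀ D D' : G → ℤ) : Prop :=
  ∀ ε > (0:ℝ), ∃ D'' : G → ℤ, SameType V D₀ D D'' ∧ linDist D' D'' < ε

/-- `D` is generic in `|D₀|`: it lies in the relative interior of an inclusion-wise
maximal cell, i.e. all sufficiently nearby divisors of `|D₀|` lie in the closed cell
of `D`. -/
def Generic (V : Set G) (D₀ D : G → ℤ) : Prop :=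
  D ∈ LinSys D₀ ∧ ∃ ε > (0:ℝ), ∀ D' ∈ LinSys D₀, linDist D D' < ε → InClosedCell V D₀ D D'

/-- The rank of `D` is at least `d`: for every effective divisor `E` of degree `d`,
`|D - E|` is nonempty. -/
def rankGe (D : G → ℤ) (d : ℕ) : Prop :=
  ∀ E : G → ℤ, FinSupp E → Effective E → deg E = (d : ℤ) →
    ∃ D' : G → ℤ, FinSupp D' ∧ Effective D' ∧ LinEquiv (fun x => D x - E x) D'

/-! ### Cycles, the canonical divisor and realizability -/

/-- A simple cycle: a subset homeomorphic to a circle. -/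
def IsCycleSet (C : Set G) : Prop :=
  Nonempty (C ≃ₜ AddCircle (1 : ℝ))

/-- The canonical divisor `K + div f` for a vertex valence function `val`. -/
noncomputable def canDiv (val : G → ℕ) (f : G → ℝ) : G → ℤ :=
  fun x => (val x : ℤ) - 2 + ordAt f x

/-- The enhanced-level-graph invariant `k(ζ) = -s_ζ(f) - 1` of a tangent direction. -/
noncomputable def kVal (f : G → ℝ) {v : G} (ζ : TangentDir v) : ℤ :=
  -(tangentSlope f ζ) - 1

/-- `v` is an inconvenient vertex of the enhanced level graph `Γ⁺(f)` (all vertex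
weights `h ≡ 0`): no `k`-value equals `-1`, and some `k`-value (of a half-edge, or of
one of the `D(v)` attached legs, which carry `k = 1`) exceeds
`Σ_{k_j < 0} (-k_j) - #{k_j < 0} - 1`.  (Legs have `k = 1 > 0` and so never contribute
to the sums, and their `k`-value is `≠ -1`.) -/
def Inconvenient (val : G → ℕ) (f : G → ℝ) (v : G) : Prop :=
  (∀ ζ : TangentDir v, kVal f ζ ≠ -1) ∧
  ∃ k₀ : ℤ, ((∃ ζ : TangentDir v, kVal f ζ = k₀) ∨ (0 < canDiv val f v ∧ k₀ = 1)) ∧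
    (∑ᶠ ζ ∈ {ζ : TangentDir v | kVal f ζ < 0}, (-kVal f ζ))
      - (({ζ : TangentDir v | kVal f ζ < 0}).ncard : ℤ) - 1 < k₀

/-- The realizability criterion of Möller–Ulirsch–Werner for the effective canonical
divisor `K + div f`: every inconvenient vertex, and every open arc on which `f` is
constant, away from the bends of `f` and from higher-valence points, is contained in a
simple cycle lying above it. -/
def RealizableFn (val : G → ℕ) (f : G → ℝ) : Prop :=
  (∀ v, Inconvenient val f v →
    ∃ Z : Set G, IsCycleSet Z ∧ v ∈ Z ∧ ∀ z ∈ Z, f v ≤ f z) ∧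
  (∀ A : Set G, IsOpenArc A → ConstOn f A → (∀ x ∈ A, ordAt f x = 0 ∧ val x = 2) →
    ∃ Z : Set G, IsCycleSet Z ∧ A ⊆ Z ∧ ∀ z ∈ Z, ∀ a ∈ A, f a ≤ f z)

/-- The realizability locus inside the canonical linear system. -/
def RealSet (val : G → ℕ) : Set (G → ℤ) :=
  {D | ∃ f : G → ℝ, IsRational f ∧ (∀ x, D x = (val x : ℤ) - 2 + ordAt f x) ∧
    RealizableFn val f}

/-! ### Tropical linear series -/

/-- The cone `R(𝔡, D)` of rational functions `f` with `D + div f ∈ 𝔡`. -/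
def coneOf (D : G → ℤ) (𝔡 : Set (G → ℤ)) : Set (G → ℝ) :=
  {f | IsRational f ∧ (fun x => D x + ordAt f x) ∈ 𝔡}

/-- A tropical linear series: a tropically convex subset of a complete linear system,
i.e. one whose cone of rational functions is a tropical submodule. -/
def TropLinearSeries (D₀ : G → ℤ) (𝔡 : Set (G → ℤ)) : Prop :=
  𝔡 ⊆ LinSys D₀ ∧
  (∀ f ∈ coneOf D₀ 𝔡, ∀ g ∈ coneOf D₀ 𝔡, (fun x => max (f x) (g x)) ∈ coneOf D₀ 𝔡) ∧
  (∀ c : ℝ, ∀ f ∈ coneOf D₀ 𝔡, (fun x => c + f x) ∈ coneOf D₀ 𝔡)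

/-- The rank of the tropical linear series `𝔡` is at least `d`:
`𝔡(-E)` is nonempty for every effective divisor `E` of degree `d`. -/
def lsRankGe (𝔡 : Set (G → ℤ)) (d : ℕ) : Prop :=
  ∀ E : G → ℤ, FinSupp E → Effective E → deg E = (d : ℤ) →
    ∃ D ∈ 𝔡, ∀ x, E x ≤ D x

/-- `D` splits in `𝔡`: some non-constant `f ∈ R(𝔡, D)`, with maximum locus `Z`, has a
boundary point `x ∈ ∂Z` with `D(x) + ord_x(f) > 0`. -/
def Splits (𝔡 : Set (G → ℤ)) (D : G → ℤ) : Prop :=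
  ∃ f ∈ coneOf D 𝔡, (¬∀ x y : G, f x = f y) ∧
    ∃ x ∈ frontier {y | ∀ z, f z ≤ f y}, 0 < D x + ordAt f x

/-- The pairing of a divisor with a test function. -/
noncomputable def pairing (D : G → ℤ) (φ : G → ℝ) : ℝ :=
  ∑ᶠ x, (D x : ℝ) * φ x

/-- The tangent space of `X` at `D` has dimension at least `r`: there are `r`
one-sided differentiable paths through `D` inside `X` whose derivatives (as linear
functionals on rational test functions) are linearly independent. -/
def TangentDimGe (X : Set (G → ℤ)) (D : G → ℤ) (r : ℕ) : Prop :=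
  ∃ (c : Fin r → ℝ → G → ℤ) (L : Fin r → (G → ℝ) → ℝ) (ε : ℝ), 0 < ε ∧
    (∀ i, c i 0 = D) ∧ (∀ i, ∀ t ∈ Set.Ico (0:ℝ) ε, c i t ∈ X) ∧
    (∀ i, ∀ φ : G → ℝ, IsRational φ →
      HasDerivWithinAt (fun t => pairing (c i t) φ) (L i φ) (Set.Ici 0) 0) ∧
    LinearIndependent ℝ L

/-! ### Components of open sets -/

theorem connectedComponentIn_eq_of_partition {T : Set G} {F : Set (Set G)}
    (hpre : ∀ A ∈ F, IsPreconnected A) (hopen : ∀ A ∈ F, IsOpen A)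
    (hdis : F.PairwiseDisjoint id) (hU : ⋃₀ F = T) {A : Set G} (hA : A ∈ F) {x : G}
    (hx : x ∈ A) : connectedComponentIn T x = A := by
  have hAT : A ⊆ T := hU ▸ subset_sUnion_of_mem hA
  apply Subset.antisymm
  · refine isPreconnected_connectedComponentIn.subset_left_of_subset_union (hopen A hA)
      (isOpen_sUnion (s := F \ {A}) fun B hB => hopen B hB.1) ?_ ?_
      ⟨x, mem_connectedComponentIn (hAT hx), hx⟩
    · rw [disjoint_sUnion_right]
      exact fun B hB => hdis hA hB.1 (Ne.symm hB.2)
    · refine (connectedComponentIn_subset T x).trans fun y hy => ?_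
      obtain ⟨B, hB, hyB⟩ := mem_sUnion.1 (hU.symm ▸ hy)
      by_cases h : B = A
      · exact Or.inl (h ▸ hyB)
      · exact Or.inr ⟨B, ⟨hB, h⟩, hyB⟩
  · exact (hpre A hA).subset_connectedComponentIn hx hAT

/-- A partition of a set into nonempty connected open sets is its set of components. -/
theorem compsOf_eq_of_partition {T : Set G} {F : Set (Set G)} (hne : ∀ A ∈ F, A.Nonempty)
    (hpre : ∀ A ∈ F, IsPreconnected A) (hopen : ∀ A ∈ F, IsOpen A)
    (hdis : F.PairwiseDisjoint id) (hU : ⋃₀ F = T) : compsOf T = F := by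
  ext C
  constructor
  · rintro ⟨x, hx, rfl⟩
    obtain ⟨A, hA, hxA⟩ := mem_sUnion.1 (hU.symm ▸ hx)
    rwa [connectedComponentIn_eq_of_partition hpre hopen hdis hU hA hxA]
  · intro hC
    obtain ⟨x, hx⟩ := hne C hC
    exact ⟨x, hU ▸ subset_sUnion_of_mem hC hx,
      (connectedComponentIn_eq_of_partition hpre hopen hdis hU hC hx).symm⟩

theorem nonempty_of_mem_compsOf {T C : Set G} (hC : C ∈ compsOf T) : C.Nonempty := by
  obtain ⟨x, hx, rfl⟩ := hC
  exact ⟨x, mem_connectedComponentIn hx⟩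

theorem subset_of_mem_compsOf {T C : Set G} (hC : C ∈ compsOf T) : C ⊆ T := by
  obtain ⟨x, hx, rfl⟩ := hC
  exact connectedComponentIn_subset T x

theorem isPreconnected_of_mem_compsOf {T C : Set G} (hC : C ∈ compsOf T) :
    IsPreconnected C := by
  obtain ⟨x, hx, rfl⟩ := hC
  exact isPreconnected_connectedComponentIn

theorem connectedComponentIn_eq_of_mem_compsOf {T C : Set G} (hC : C ∈ compsOf T) {x : G}
    (hx : x ∈ C) : connectedComponentIn T x = C := by
  obtain ⟨y, hy, rfl⟩ := hC
  exact (connectedComponentIn_eq hx).symm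

theorem pairwiseDisjoint_compsOf (T : Set G) : (compsOf T).PairwiseDisjoint id := by
  intro A hA B hB hAB
  rw [Function.onFun, Set.disjoint_left]
  intro x hxA hxB
  exact hAB ((connectedComponentIn_eq_of_mem_compsOf hA hxA).symm.trans
    (connectedComponentIn_eq_of_mem_compsOf hB hxB))

theorem sUnion_compsOf (T : Set G) : ⋃₀ compsOf T = T := by
  apply Subset.antisymm
  · exact sUnion_subset fun C hC => subset_of_mem_compsOf hC
  · exact fun x hx => ⟨_, ⟨x, hx, rfl⟩, mem_connectedComponentIn hx⟩

theorem isOpen_of_mem_compsOf {T : Set G} (hT : IsOpen T) (hfin : (compsOf T).Finite)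
    {C : Set G} (hC : C ∈ compsOf T) : IsOpen C := by
  have hcl : ∀ B ∈ compsOf T, T ∩ closure B ⊆ B := by
    intro B hB
    obtain ⟨x, hx⟩ := nonempty_of_mem_compsOf hB
    have hpre : IsPreconnected (T ∩ closure B) :=
      (isPreconnected_of_mem_compsOf hB).subset_closure
        (subset_inter (subset_of_mem_compsOf hB) subset_closure) inter_subset_right
    have := hpre.subset_connectedComponentIn
      ⟨subset_of_mem_compsOf hB hx, subset_closure hx⟩ inter_subset_left
    rwa [connectedComponentIn_eq_of_mem_compsOf hB hx] at this
  have hEq : C = T \ ⋃ B ∈ compsOf T \ {C}, closure B := by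
    apply Subset.antisymm
    · intro x hx
      refine ⟨subset_of_mem_compsOf hC hx, fun h => ?_⟩
      obtain ⟨B, hB, hxB⟩ := mem_iUnion₂.1 h
      exact Set.disjoint_left.1 (pairwiseDisjoint_compsOf T hB.1 hC hB.2)
        (hcl B hB.1 ⟨subset_of_mem_compsOf hC hx, hxB⟩) hx
    · rintro x ⟨hxT, hx⟩
      obtain ⟨B, hB, hxB⟩ := mem_sUnion.1 ((sUnion_compsOf T).symm ▸ hxT)
      by_cases h : B = C
      · exact h ▸ hxB
      · exact absurd (mem_iUnion₂.2 ⟨B, ⟨hB, h⟩, subset_closure hxB⟩) hx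
  rw [hEq]
  exact hT.sdiff ((hfin.subset sdiff_subset).isClosed_biUnion fun B _ => isClosed_closure)

/-! ### Isometrically parametrized arcs -/

/-- `c` restricts to an isometric embedding of the open interval `(a, b)`. -/
def IsometricOn (c : ℝ → G) (a b : ℝ) : Prop :=
  ∀ s ∈ Ioo a b, ∀ t ∈ Ioo a b, dist (c s) (c t) = |s - t|

namespace IsometricOn

variable {c : ℝ → G} {a b a' b' : ℝ}

theorem mono (h : IsometricOn c a b) (ha : a ≤ a') (hb : b' ≤ b) : IsometricOn c a' b' :=
  fun s hs t ht => h s (Ioo_subset_Ioo ha hb hs) t (Ioo_subset_Ioo ha hb ht)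

theorem injOn (h : IsometricOn c a b) : InjOn c (Ioo a b) := by
  intro s hs t ht hst
  have := h s hs t ht
  rw [hst, dist_self, eq_comm, abs_eq_zero, sub_eq_zero] at this
  exact this

theorem continuousOn (h : IsometricOn c a b) : ContinuousOn c (Ioo a b) := by
  rw [Metric.continuousOn_iff]
  intro t ht ε hε
  refine ⟨ε, hε, fun s hs hst => ?_⟩
  rwa [h s hs t ht, ← Real.dist_eq]

theorem isPreconnected_image (h : IsometricOn c a b) : IsPreconnected (c '' Ioo a b) :=
  isPreconnected_Ioo.image c h.continuousOn

theorem isOpen_image (h : IsometricOn c a b) (hopen : IsOpen (c '' Ioo a b)) (ha : a ≤ a')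
    (hb : b' ≤ b) : IsOpen (c '' Ioo a' b') := by
  rw [Metric.isOpen_iff] at hopen ⊢
  rintro _ ⟨s, hs, rfl⟩
  have hs' := Ioo_subset_Ioo ha hb hs
  obtain ⟨r, hr, hball⟩ := hopen _ (mem_image_of_mem c hs')
  refine ⟨min r (min (s - a') (b' - s)), lt_min hr (lt_min (by linarith [hs.1])
    (by linarith [hs.2])), fun z hz => ?_⟩
  rw [Metric.mem_ball, lt_min_iff, lt_min_iff] at hz
  obtain ⟨t, ht, rfl⟩ := hball (Metric.mem_ball.2 hz.1)
  rw [h t ht s hs'] at hz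
  have h₁ := abs_lt.1 hz.2.1
  have h₂ := abs_lt.1 hz.2.2
  exact ⟨t, ⟨by linarith, by linarith⟩, rfl⟩

theorem image_diff_singleton (h : IsometricOn c a b) {t : ℝ} (ht : t ∈ Ioo a b) :
    c '' Ioo a b \ {c t} = c '' Ioo a t ∪ c '' Ioo t b := by
  rw [← image_singleton, ← h.injOn.image_sdiff_subset (singleton_subset_iff.2 ht), ← image_union]
  congr 1
  ext s
  simp only [mem_sdiff, mem_Ioo, mem_singleton_iff, mem_union] at ht ⊢
  constructor
  · rintro ⟨⟨h₁, h₂⟩, h₃⟩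
    rcases lt_or_gt_of_ne h₃ with h₄ | h₄
    · exact Or.inl ⟨h₁, h₄⟩
    · exact Or.inr ⟨h₄, h₂⟩
  · rintro (⟨h₁, h₂⟩ | ⟨h₁, h₂⟩)
    · exact ⟨⟨h₁, h₂.trans ht.2⟩, h₂.ne⟩
    · exact ⟨⟨ht.1.trans h₁, h₂⟩, h₁.ne'⟩

theorem disjoint_image (h : IsometricOn c a b) {t : ℝ} (ht : t ∈ Ioo a b) :
    Disjoint (c '' Ioo a t) (c '' Ioo t b) := by
  rw [Set.disjoint_left]
  rintro _ ⟨s, hs, rfl⟩ ⟨s', hs', hss'⟩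
  have := h.injOn (Ioo_subset_Ioo ht.1.le le_rfl hs') (Ioo_subset_Ioo le_rfl ht.2.le hs) hss'
  exact lt_asymm hs.2 (this ▸ hs'.1)

theorem isOpenArc (h : IsometricOn c a b) (hab : a < b) : IsOpenArc (c '' Ioo a b) :=
  ⟨a, b, c, hab, h, rfl⟩

end IsometricOn

theorem compsOf_arc_diff_singleton {c : ℝ → G} {a b t : ℝ} (h : IsometricOn c a b)
    (hopen : IsOpen (c '' Ioo a b)) (ht : t ∈ Ioo a b) :
    compsOf (c '' Ioo a b \ {c t}) = {c '' Ioo a t, c '' Ioo t b} := by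
  apply compsOf_eq_of_partition
  · rintro A (rfl | rfl)
    · exact (nonempty_Ioo.2 ht.1).image c
    · exact (nonempty_Ioo.2 ht.2).image c
  · rintro A (rfl | rfl)
    · exact (h.mono le_rfl ht.2.le).isPreconnected_image
    · exact (h.mono ht.1.le le_rfl).isPreconnected_image
  · rintro A (rfl | rfl)
    · exact h.isOpen_image hopen le_rfl ht.2.le
    · exact h.isOpen_image hopen ht.1.le le_rfl
  · rw [Set.pairwiseDisjoint_insert]
    refine ⟨pairwiseDisjoint_singleton _ _, ?_⟩
    rintro A rfl -
    exact h.disjoint_image ht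
  · rw [sUnion_pair, h.image_diff_singleton ht]

theorem image_Ioo_ne {c : ℝ → G} {a b t : ℝ} (h : IsometricOn c a b) (ht : t ∈ Ioo a b) :
    c '' Ioo a t ≠ c '' Ioo t b := by
  intro hEq
  have := h.disjoint_image ht
  rw [← hEq, disjoint_self, bot_eq_empty] at this
  exact ((nonempty_Ioo.2 ht.1).image c).ne_empty this

/-! ### Valences -/

theorem starGlue_isOpen_iff {v : ℕ} {ε : ℝ} {s : Set (StarGlue v ε)} :
    IsOpen s ↔ IsOpen ((fun p => (Quotient.mk (starSetoid v ε) p : StarGlue v ε)) ⁻¹' s) :=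
  Iff.rfl

/-- The parametrization of a star-shaped neighbourhood by its branches. -/
theorem IsStarNbhdOf.exists_branches {x : G} {v : ℕ} {U : Set G} (h : IsStarNbhdOf x v U) :
    ∃ (ε : ℝ) (hε : 0 < ε) (β : Fin v → Ico (0 : ℝ) ε → G), x ∈ U ∧
      (∀ i, Continuous (β i)) ∧ (∀ i, β i ⟨0, le_rfl, hε⟩ = x) ∧
      (∀ y ∈ U, ∃ i t, β i t = y) ∧ (∀ i t, β i t ∈ U) ∧
      (∀ i j s t, β i s = β j t → (i = j ∧ s = t) ∨ ((s : ℝ) = 0 ∧ (t : ℝ) = 0)) ∧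
      (∀ i, ∃ O, IsOpen O ∧ U ∩ O = β i '' {t | 0 < (t : ℝ)}) ∧
      ∀ η : Fin v → ℝ, (∀ i, 0 < η i) →
        ∃ O, IsOpen O ∧ U ∩ O = ⋃ i, β i '' {t | (t : ℝ) < η i} := by
  obtain ⟨ε, hε, φ, hx, hφ⟩ := h
  let q : Fin v × Ico (0 : ℝ) ε → StarGlue v ε := fun p => Quotient.mk (starSetoid v ε) p
  have hq : Continuous q := continuous_def.2 fun s hs => starGlue_isOpen_iff.1 hs
  have hqe : ∀ p p', q p = q p' ↔ p = p' ∨ ((p.2 : ℝ) = 0 ∧ (p'.2 : ℝ) = 0) :=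
    fun p p' => Quotient.eq (r := starSetoid v ε)
  have hqs : ∀ z, ∃ p, q p = z := fun z => Quotient.exists_rep z
  have key : ∀ s : Set (Fin v × Ico (0 : ℝ) ε), IsOpen s →
      (∀ p ∈ s, ∀ p', q p' = q p → p' ∈ s) →
      ∃ O : Set G, IsOpen O ∧ U ∩ O = (fun p => (φ.symm (q p) : G)) '' s := by
    intro s hs hsat
    have h₁ : IsOpen (q '' s) := by
      rw [starGlue_isOpen_iff]
      convert hs using 1
      ext p
      constructor
      · rintro ⟨p', hp', h⟩
        exact hsat p' hp' p h.symm
      · exact fun hp => ⟨p, hp, rfl⟩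
    obtain ⟨O, hO, hOe⟩ := isOpen_induced_iff.1 (h₁.preimage φ.continuous)
    refine ⟨O, hO, ?_⟩
    rw [← Subtype.image_preimage_coe, hOe, ← φ.image_symm, image_image, image_image]
  refine ⟨ε, hε, fun i t => φ.symm (q (i, t)), hx, ?_, ?_, ?_, ?_, ?_, ?_, ?_⟩
  · intro i
    exact continuous_subtype_val.comp (φ.symm.continuous.comp (hq.comp (by fun_prop)))
  · intro i
    have : φ.symm (q (i, ⟨0, le_rfl, hε⟩)) = ⟨x, hx⟩ := by
      rw [Homeomorph.symm_apply_eq]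
      exact (hφ i).symm
    simp only [this]
  · intro y hy
    obtain ⟨⟨i, t⟩, hp⟩ := hqs (φ ⟨y, hy⟩)
    refine ⟨i, t, ?_⟩
    simp only [hp, Homeomorph.symm_apply_apply]
  · exact fun i t => Subtype.property _
  · intro i j s t hst
    have := φ.symm.injective (Subtype.ext hst)
    rw [hqe] at this
    simpa using this
  · intro i
    obtain ⟨O, hO, hOe⟩ := key {p | p.1 = i ∧ 0 < (p.2 : ℝ)}
      (((isOpen_discrete {i}).preimage continuous_fst).inter
        (isOpen_lt continuous_const (continuous_subtype_val.comp continuous_snd))) (by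
        rintro ⟨j, s⟩ ⟨rfl, hs⟩ ⟨k, t⟩ h
        rw [hqe] at h
        rcases h with h | h
        · rw [h]; exact ⟨rfl, hs⟩
        · exact absurd h.2 hs.ne')
    refine ⟨O, hO, hOe.trans ?_⟩
    ext y
    constructor
    · rintro ⟨⟨j, s⟩, ⟨rfl, hs⟩, rfl⟩
      exact ⟨s, hs, rfl⟩
    · rintro ⟨s, hs, rfl⟩
      exact ⟨(i, s), ⟨rfl, hs⟩, rfl⟩
  · intro η hη
    obtain ⟨O, hO, hOe⟩ := key {p | (p.2 : ℝ) < η p.1}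
      (isOpen_lt (continuous_subtype_val.comp continuous_snd) (continuous_of_discreteTopology.comp continuous_fst)) (by
        rintro ⟨j, s⟩ hs ⟨k, t⟩ h
        rw [hqe] at h
        rcases h with h | h
        · rw [h]; exact hs
        · rw [mem_ofPred_eq, h.1]; exact hη _)
    refine ⟨O, hO, hOe.trans ?_⟩
    ext y
    simp only [mem_iUnion]
    constructor
    · rintro ⟨⟨j, s⟩, hs, rfl⟩
      exact ⟨j, s, hs, rfl⟩
    · rintro ⟨j, s, hs, rfl⟩
      exact ⟨(j, s), hs, rfl⟩

/-- The valence of a point counts the components of a small punctured neighbourhood that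
accumulate at the point. -/
theorem IsStarNbhdOf.ncard_eq {x : G} {v : ℕ} {U B : Set G} (h : IsStarNbhdOf x v U)
    (hB : IsOpen B) (hxB : x ∈ B) (hBU : B ⊆ U) :
    {C ∈ compsOf (B \ {x}) | x ∈ closure C}.ncard = v := by
  obtain ⟨ε, hε, β, hxU, hcont, hzero, hsurj, hmem, hinj, hbr, hnb⟩ := h.exists_branches
  have hη : ∀ i, ∃ η > (0 : ℝ), η ≤ ε ∧ ∀ t : Ico (0 : ℝ) ε, (t : ℝ) < η → β i t ∈ B := by
    intro i
    have h₁ := ((hcont i).isOpen_preimage B hB)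
    obtain ⟨r, hr, hball⟩ := Metric.isOpen_iff.1 h₁ ⟨0, le_rfl, hε⟩
      (by rw [mem_preimage, hzero]; exact hxB)
    refine ⟨min r ε, lt_min hr hε, min_le_right _ _, fun t ht => hball ?_⟩
    rw [Metric.mem_ball, Subtype.dist_eq, Real.dist_eq, sub_zero, abs_of_nonneg t.2.1]
    exact lt_of_lt_of_le ht (min_le_left _ _)
  choose η hη0 hηε hηB using hη
  choose O hO hOe using hbr
  obtain ⟨N, hN, hNe⟩ := hnb η hη0
  have hxN : N ∈ nhds x := by
    refine hN.mem_nhds ?_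
    obtain ⟨i, t, hit⟩ := hsurj x hxU
    have : x ∈ U ∩ N := by
      rw [hNe, mem_iUnion]
      refine ⟨i, ⟨0, le_rfl, hε⟩, hη0 i, hzero i⟩
    exact this.2
  have hne : ∀ i t, β i t ≠ x ↔ 0 < (t : ℝ) := by
    intro i t
    constructor
    · intro h
      refine lt_of_le_of_ne t.2.1 fun h0 => h ?_
      rw [← hzero i]
      congr 1
      exact Subtype.ext h0.symm
    · intro h0 h
      rw [← hzero i] at h
      rcases hinj _ _ _ _ h with h | h
      · rw [h.2] at h0; exact lt_irrefl _ h0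
      · exact h0.ne' h.1
  -- the germs of the branches
  let T : Fin v → Set G := fun i => β i '' {t | 0 < (t : ℝ) ∧ (t : ℝ) < η i}
  have hT : ∀ i, IsPreconnected (T i) := by
    intro i
    refine IsPreconnected.image ?_ _ (hcont i).continuousOn
    rw [← Topology.IsInducing.subtypeVal.isPreconnected_image]
    convert isPreconnected_Ioo (a := (0 : ℝ)) (b := η i) using 1
    ext t
    constructor
    · rintro ⟨s, hs, rfl⟩
      exact hs
    · exact fun ht => ⟨⟨t, ht.1.le, ht.2.trans_le (hηε i)⟩, ht, rfl⟩
  have hTB : ∀ i, T i ⊆ B \ {x} := by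
    rintro i _ ⟨t, ht, rfl⟩
    exact ⟨hηB i t ht.2, (hne i t).2 ht.1⟩
  have hTcl : ∀ i, x ∈ closure (T i) := by
    intro i
    rw [← hzero i]
    refine image_closure_subset_closure_image (hcont i) (mem_image_of_mem _ ?_)
    rw [Metric.mem_closure_iff]
    intro r hr
    have h₁ : 0 < min r (η i) := lt_min hr (hη0 i)
    refine ⟨⟨min r (η i) / 2, by positivity, ?_⟩, ⟨?_, ?_⟩, ?_⟩
    · have := min_le_right r (η i); have := hηε i; linarith
    · change 0 < min r (η i) / 2; positivity
    · change min r (η i) / 2 < η i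
      have := min_le_right r (η i); linarith [hη0 i]
    · rw [Subtype.dist_eq, Real.dist_eq, abs_sub_comm, sub_zero, abs_of_pos (by positivity)]
      have := min_le_left r (η i); linarith
  let m : ∀ i, Ico (0 : ℝ) ε := fun i =>
    ⟨η i / 2, by have := hη0 i; positivity, by linarith [hη0 i, hηε i]⟩
  have hm : ∀ i, β i (m i) ∈ T i := fun i =>
    ⟨m i, ⟨half_pos (hη0 i), half_lt_self (hη0 i)⟩, rfl⟩
  let K : Fin v → Set G := fun i => connectedComponentIn (B \ {x}) (β i (m i))
  have hTK : ∀ i, T i ⊆ K i := fun i => (hT i).subset_connectedComponentIn (hm i) (hTB i)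
  have hOdis : ∀ i j, i ≠ j → Disjoint (B ∩ O i) (B ∩ O j) := by
    intro i j hij
    rw [Set.disjoint_left]
    rintro y ⟨hyB, hyi⟩ ⟨-, hyj⟩
    obtain ⟨s, hs, rfl⟩ : y ∈ β i '' {t | 0 < (t : ℝ)} := hOe i ▸ ⟨hBU hyB, hyi⟩
    obtain ⟨t, ht, hst⟩ : β i s ∈ β j '' {t | 0 < (t : ℝ)} :=
      hOe j ▸ ⟨hBU hyB, hyj⟩
    rcases hinj _ _ _ _ hst with h | h
    · exact hij h.1.symm
    · exact (ne_of_gt ht) h.1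
  have hKO : ∀ i, K i ⊆ B ∩ O i := by
    intro i
    refine isPreconnected_connectedComponentIn.subset_left_of_subset_union (hB.inter (hO i))
      (v := ⋃ j ∈ {j | j ≠ i}, B ∩ O j)
      (isOpen_biUnion fun j _ => hB.inter (hO j)) ?_ ?_
      ⟨_, mem_connectedComponentIn (hTB i (hm i)), hηB i _ (half_lt_self (hη0 i)), ?_⟩
    · rw [disjoint_iUnion₂_right]
      exact fun j hj => hOdis i j hj.symm
    · refine (connectedComponentIn_subset _ _).trans ?_
      rintro y ⟨hyB, hyx⟩
      obtain ⟨j, t, rfl⟩ := hsurj y (hBU hyB)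
      have hj : β j t ∈ U ∩ O j := (hOe j).symm ▸ ⟨t, (hne j t).1 hyx, rfl⟩
      by_cases hji : j = i
      · subst hji
        exact Or.inl ⟨hyB, hj.2⟩
      · exact Or.inr (mem_iUnion₂.2 ⟨j, hji, hyB, hj.2⟩)
    · have : β i (m i) ∈ U ∩ O i := (hOe i).symm ▸ ⟨m i, half_pos (hη0 i), rfl⟩
      exact this.2
  have hKinj : Injective K := by
    intro i j hij
    by_contra hne'
    have h₁ := hKO i (hTK i (hm i))
    have h₂ := hKO j (hij ▸ hTK i (hm i))
    exact Set.disjoint_left.1 (hOdis i j hne') h₁ h₂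
  have hrange : {C ∈ compsOf (B \ {x}) | x ∈ closure C} = range K := by
    ext C
    constructor
    · rintro ⟨hC, hxC⟩
      obtain ⟨z, hzN, hzC⟩ := mem_closure_iff_nhds.1 hxC N hxN
      have hzB := subset_of_mem_compsOf hC hzC
      have : z ∈ ⋃ i, β i '' {t | (t : ℝ) < η i} := hNe ▸ ⟨hBU hzB.1, hzN⟩
      obtain ⟨j, t, ht, rfl⟩ := mem_iUnion.1 this
      refine ⟨j, ?_⟩
      rw [← connectedComponentIn_eq_of_mem_compsOf hC hzC]
      exact connectedComponentIn_eq (hTK j ⟨t, ⟨(hne j t).1 hzB.2, ht⟩, rfl⟩)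
    · rintro ⟨i, rfl⟩
      exact ⟨⟨_, hTB i (hm i), rfl⟩, closure_mono (hTK i) (hTcl i)⟩
  rw [hrange, ← image_univ, ncard_image_of_injective _ hKinj, ncard_univ, Nat.card_fin]

theorem HasValence.unique {x : G} {v w : ℕ} (hv : HasValence x v) (hw : HasValence x w) :
    v = w := by
  obtain ⟨U, hU, hUv⟩ := hv
  obtain ⟨W, hW, hWw⟩ := hw
  obtain ⟨B, hBUW, hB, hxB⟩ := mem_nhds_iff.1 (Filter.inter_mem hU hW)
  rw [← hUv.ncard_eq hB hxB (hBUW.trans inter_subset_left),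
    hWw.ncard_eq hB hxB (hBUW.trans inter_subset_right)]

/-- Points in the interior of an open arc have valence two. -/
theorem HasValence.eq_two {c : ℝ → G} {a b t : ℝ} {v : ℕ} (h : IsometricOn c a b)
    (hopen : IsOpen (c '' Ioo a b)) (ht : t ∈ Ioo a b) (hv : HasValence (c t) v) : v = 2 := by
  obtain ⟨U, hU, hUv⟩ := hv
  obtain ⟨r, hr, hball⟩ := Metric.mem_nhds_iff.1 hU
  let a' := max a (t - r)
  let b' := min b (t + r)
  have hat : a' < t := max_lt ht.1 (by linarith)
  have htb : t < b' := lt_min ht.2 (by linarith)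
  have h' : IsometricOn c a' b' := h.mono (le_max_left _ _) (min_le_left _ _)
  have hopen' := h.isOpen_image hopen (le_max_left a (t - r)) (min_le_left b (t + r))
  have hsub : c '' Ioo a' b' ⊆ U := by
    rintro _ ⟨s, hs, rfl⟩
    refine hball ?_
    rw [Metric.mem_ball, h' s hs t ⟨hat, htb⟩, abs_lt]
    have h₁ := le_max_right a (t - r)
    have h₂ := min_le_right b (t + r)
    exact ⟨by linarith [hs.1], by linarith [hs.2]⟩
  have hcl : ∀ S : Set ℝ, S ⊆ Ioo a' b' → t ∈ closure S → c t ∈ closure (c '' S) := by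
    intro S hS htS
    exact ((h'.continuousOn t ⟨hat, htb⟩).mono hS).mem_closure_image htS
  rw [← hUv.ncard_eq hopen' (mem_image_of_mem c ⟨hat, htb⟩) hsub,
    compsOf_arc_diff_singleton h' hopen' ⟨hat, htb⟩]
  have : {C ∈ ({c '' Ioo a' t, c '' Ioo t b'} : Set (Set G)) | c t ∈ closure C} =
      {c '' Ioo a' t, c '' Ioo t b'} := by
    refine sep_eq_self_iff_mem_true.2 ?_
    rintro C (rfl | rfl)
    · refine hcl _ (Ioo_subset_Ioo le_rfl htb.le) ?_
      rw [closure_Ioo hat.ne]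
      exact right_mem_Icc.2 hat.le
    · refine hcl _ (Ioo_subset_Ioo hat.le le_rfl) ?_
      rw [closure_Ioo htb.ne]
      exact left_mem_Icc.2 htb.le
  rw [this, ncard_pair (image_Ioo_ne h' ⟨hat, htb⟩)]

/-! ### Additivity of the Euler characteristic -/

theorem ncard_eq_finsum_mem {α : Type*} {s : Set α} (hs : s.Finite) :
    (s.ncard : ℤ) = ∑ᶠ _x ∈ s, (1 : ℤ) := by
  rw [finsum_mem_eq_finite_toFinset_sum _ hs, ncard_eq_toFinset_card s hs]
  simp

/-- The negative of the Euler characteristic, computed from a set of vertices. -/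
noncomputable def negEuler (val : G → ℕ) (W : Set G) : ℤ :=
  (∑ᶠ x ∈ W, ((val x : ℤ) - 1)) - (compsOf Wᶜ).ncard

theorem IsGraphModel.isOpen_edge {W C : Set G} (hW : IsGraphModel W) (hC : C ∈ compsOf Wᶜ) :
    IsOpen C :=
  isOpen_of_mem_compsOf hW.1.isClosed.isOpen_compl hW.2.1 hC

theorem IsGraphModel.exists_arc {W : Set G} (hW : IsGraphModel W) {p : G} (hp : p ∉ W) :
    ∃ (c : ℝ → G) (a b t : ℝ), t ∈ Ioo a b ∧ c t = p ∧ IsometricOn c a b ∧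
      IsOpen (c '' Ioo a b) ∧ c '' Ioo a b ∈ compsOf Wᶜ := by
  have hC : connectedComponentIn Wᶜ p ∈ compsOf Wᶜ := ⟨p, hp, rfl⟩
  obtain ⟨a, b, c, -, hiso, hCe⟩ := hW.2.2 _ hC
  have hpC : p ∈ connectedComponentIn Wᶜ p := mem_connectedComponentIn hp
  have hop := hW.isOpen_edge hC
  rw [hCe] at hpC hC hop
  obtain ⟨t, ht, rfl⟩ := hpC
  exact ⟨c, a, b, t, ht, rfl, hiso, hop, hC⟩

theorem IsGraphModel.valence_eq_two {W : Set G} (hW : IsGraphModel W) {p : G} (hp : p ∉ W)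
    {v : ℕ} (hv : HasValence p v) : v = 2 := by
  obtain ⟨c, a, b, t, ht, rfl, hiso, hop, -⟩ := hW.exists_arc hp
  exact hv.eq_two hiso hop ht

/-- Subdividing an edge of a model does not change the Euler characteristic. -/
theorem IsGraphModel.subdivide {W : Set G} (hW : IsGraphModel W) {val : G → ℕ}
    (hval : ∀ x, HasValence x (val x)) {p : G} (hp : p ∉ W) :
    IsGraphModel (insert p W) ∧ negEuler val (insert p W) = negEuler val W := by
  have hp2 := hW.valence_eq_two hp (hval p)
  obtain ⟨c, a, b, t, ht, rfl, hiso, hop, hC⟩ := hW.exists_arc hp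
  set C := c '' Ioo a b with hCdef
  set A₁ := c '' Ioo a t
  set A₂ := c '' Ioo t b
  have hsplit : C \ {c t} = A₁ ∪ A₂ := hiso.image_diff_singleton ht
  have hA₁C : A₁ ⊆ C := image_mono (Ioo_subset_Ioo le_rfl ht.2.le)
  have hA₂C : A₂ ⊆ C := image_mono (Ioo_subset_Ioo ht.1.le le_rfl)
  have hA₁n : A₁.Nonempty := (nonempty_Ioo.2 ht.1).image c
  have hA₂n : A₂.Nonempty := (nonempty_Ioo.2 ht.2).image c
  have hA₁i := hiso.mono le_rfl ht.2.le
  have hA₂i := hiso.mono ht.1.le le_rfl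
  have hdisC : ∀ B ∈ compsOf Wᶜ \ {C}, Disjoint C B := fun B hB =>
    pairwiseDisjoint_compsOf _ hC hB.1 (Ne.symm hB.2)
  have hcomps : compsOf (insert (c t) W)ᶜ =
      insert A₁ (insert A₂ (compsOf Wᶜ \ {C})) := by
    apply compsOf_eq_of_partition
    · rintro B (rfl | rfl | hB)
      · exact hA₁n
      · exact hA₂n
      · exact nonempty_of_mem_compsOf hB.1
    · rintro B (rfl | rfl | hB)
      · exact hA₁i.isPreconnected_image
      · exact hA₂i.isPreconnected_image
      · exact isPreconnected_of_mem_compsOf hB.1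
    · rintro B (rfl | rfl | hB)
      · exact hiso.isOpen_image hop le_rfl ht.2.le
      · exact hiso.isOpen_image hop ht.1.le le_rfl
      · exact hW.isOpen_edge hB.1
    · refine (((pairwiseDisjoint_compsOf Wᶜ).subset sdiff_subset).insert ?_).insert ?_
      · exact fun B hB _ => (hdisC B hB).mono_left hA₂C
      · rintro B (rfl | hB) -
        · exact hiso.disjoint_image ht
        · exact (hdisC B hB).mono_left hA₁C
    · rw [sUnion_insert, sUnion_insert, ← union_assoc, ← hsplit]
      ext y
      have hyC : y ∈ C → y ∉ W := fun h => subset_of_mem_compsOf hC h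
      constructor
      · rintro (h | ⟨B, hB, hyB⟩)
        · rintro (h' | h')
          · exact h.2 h'
          · exact hyC h.1 h'
        · rintro (rfl | h')
          · exact Set.disjoint_left.1 (hdisC B hB) (mem_image_of_mem c ht) hyB
          · exact subset_of_mem_compsOf hB.1 hyB h'
      · intro hy
        rw [mem_compl_iff, mem_insert_iff, not_or] at hy
        obtain ⟨B, hB, hyB⟩ := (sUnion_compsOf Wᶜ).superset hy.2
        by_cases h : B = C
        · exact Or.inl ⟨h ▸ hyB, hy.1⟩
        · exact Or.inr ⟨B, ⟨hB, h⟩, hyB⟩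
  have hfin : (compsOf Wᶜ \ {C}).Finite := hW.2.1.subset sdiff_subset
  have hA₂ : A₂ ∉ compsOf Wᶜ \ {C} := fun h =>
    hA₂n.ne_empty (disjoint_self.1 ((hdisC _ h).mono_left hA₂C))
  have hA₁ : A₁ ∉ insert A₂ (compsOf Wᶜ \ {C}) := by
    rintro (h | h)
    · exact image_Ioo_ne hiso ht h
    · exact hA₁n.ne_empty (disjoint_self.1 ((hdisC _ h).mono_left hA₁C))
  refine ⟨⟨hW.1.insert _, hcomps ▸ (hfin.insert _).insert _, ?_⟩, ?_⟩
  · rw [hcomps]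
    rintro B (rfl | rfl | hB)
    · exact hA₁i.isOpenArc ht.1
    · exact hA₂i.isOpenArc ht.2
    · exact hW.2.2 B hB.1
  · have hcard := ncard_sdiff_singleton_add_one hC hW.2.1
    rw [negEuler, negEuler, hcomps, ncard_insert_of_notMem hA₁ (hfin.insert _),
      ncard_insert_of_notMem hA₂ hfin, finsum_mem_insert _ hp hW.1, hp2, ← hcard]
    push_cast
    ring

theorem IsGraphModel.union {W F : Set G} (hW : IsGraphModel W) {val : G → ℕ}
    (hval : ∀ x, HasValence x (val x)) (hF : F.Finite) :
    IsGraphModel (F ∪ W) ∧ negEuler val (F ∪ W) = negEuler val W := by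
  induction F, hF using Set.Finite.induction_on with
  | empty => simpa using hW
  | @insert p F _ _ ih =>
    rw [insert_union]
    by_cases h : p ∈ F ∪ W
    · rwa [insert_eq_of_mem h]
    · obtain ⟨h₁, h₂⟩ := ih.1.subdivide hval h
      exact ⟨h₁, h₂.trans ih.2⟩

/-- The Euler characteristic does not depend on the model. -/
theorem IsGraphModel.negEuler_eq {W W' : Set G} (hW : IsGraphModel W) (hW' : IsGraphModel W')
    {val : G → ℕ} (hval : ∀ x, HasValence x (val x)) : negEuler val W = negEuler val W' := by
  rw [← (hW.union hval hW'.1).2, ← (hW'.union hval hW.1).2, union_comm]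

theorem compsOf_of_isPreconnected {U : Set G} (hU : IsPreconnected U) (hne : U.Nonempty) :
    compsOf U = {U} := by
  ext C
  constructor
  · rintro ⟨x, hx, rfl⟩
    exact hU.connectedComponentIn hx
  · rintro rfl
    obtain ⟨x, hx⟩ := hne
    exact ⟨x, hx, (hU.connectedComponentIn hx).symm⟩

theorem HasGenusOpen.exists_model {U : Set G} {g : ℤ} (hg : HasGenusOpen U g)
    (hU : IsPreconnected U) (hne : U.Nonempty) {val : G → ℕ}
    (hval : ∀ x, HasValence x (val x)) :
    ∃ W ⊆ U, W.Finite ∧ (compsOf (U \ W)).Finite ∧ (∀ C ∈ compsOf (U \ W), IsOpenArc C) ∧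
      (∑ᶠ x ∈ W, ((val x : ℤ) - 1)) - (compsOf (U \ W)).ncard = g - 1 := by
  obtain ⟨W, val', ⟨hWU, hWf, hWv, hfin, harc, -⟩, rfl⟩ := hg
  refine ⟨W, hWU, hWf, hfin, harc, ?_⟩
  have hsum : ∑ᶠ x ∈ W, (val' x : ℤ) = ∑ᶠ x ∈ W, (val x : ℤ) := by
    refine finsum_mem_congr rfl fun x hx => ?_
    obtain ⟨B, hB, -, hBs⟩ := hWv x hx
    rw [HasValence.unique ⟨B, hB, hBs⟩ (hval x)]
  rw [compsOf_of_isPreconnected hU hne, ncard_singleton, hsum,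
    finsum_mem_sub_distrib _ _ hWf, ← ncard_eq_finsum_mem hWf]
  push_cast
  ring

theorem IsGraphModel.finite_compsOf_compl {V S : Set G} (hV : IsGraphModel V) {val : G → ℕ}
    (hval : ∀ x, HasValence x (val x)) (hS : S.Finite) : (compsOf Sᶜ).Finite := by
  refine ((hV.1.image (connectedComponentIn Sᶜ)).union (hV.union hval hS).1.2.1).subset ?_
  rintro C hC
  by_cases h : ∃ v ∈ V, v ∈ C
  · obtain ⟨v, hv, hvC⟩ := h
    exact Or.inl ⟨v, hv, connectedComponentIn_eq_of_mem_compsOf hC hvC⟩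
  · push Not at h
    right
    obtain ⟨x, hx⟩ := nonempty_of_mem_compsOf hC
    have hCsub : C ⊆ (S ∪ V)ᶜ := fun y hy => not_or.2
      ⟨subset_of_mem_compsOf hC hy, fun hyV => h y hyV hy⟩
    refine ⟨x, hCsub hx, Subset.antisymm
      ((isPreconnected_of_mem_compsOf hC).subset_connectedComponentIn hx hCsub) ?_⟩
    rw [← connectedComponentIn_eq_of_mem_compsOf hC hx]
    exact connectedComponentIn_mono x (compl_subset_compl.2 subset_union_left)

/-- The genus of a connected graph in terms of the genera of the components of the complement
of finitely many interior points of edges. -/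
theorem genus_eq_sum_of_cut [ConnectedSpace G] {V S : Set G} (hV : IsGraphModel V)
    {val : G → ℕ} (hval : ∀ x, HasValence x (val x)) (hS : S.Finite) (hSV : Disjoint S V)
    {g : ℤ} (hg : HasGenusOpen (univ : Set G) g) {gen : Set G → ℤ}
    (hgen : ∀ C ∈ compsOf Sᶜ, HasGenusOpen C (gen C)) :
    g - 1 = S.ncard + ∑ᶠ C ∈ compsOf Sᶜ, (gen C - 1) := by
  have hfin : (compsOf Sᶜ).Finite := hV.finite_compsOf_compl hval hS
  have hopen : ∀ C ∈ compsOf Sᶜ, IsOpen C := fun C hC =>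
    isOpen_of_mem_compsOf hS.isClosed.isOpen_compl hfin hC
  obtain ⟨V₀, -, hV₀f, hV₀c, hV₀a, hV₀⟩ := hg.exists_model isPreconnected_univ univ_nonempty hval
  rw [← compl_eq_univ_sdiff] at hV₀c hV₀a hV₀
  have hmodel := fun C hC => (hgen C hC).exists_model (isPreconnected_of_mem_compsOf hC)
    (nonempty_of_mem_compsOf hC) hval
  choose! P hPC hPf hPc hPa hP using hmodel
  have hPdis : (compsOf Sᶜ).PairwiseDisjoint P := fun C hC C' hC' h =>
    (pairwiseDisjoint_compsOf Sᶜ hC hC' h).mono (hPC C hC) (hPC C' hC')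
  have hEdis : (compsOf Sᶜ).PairwiseDisjoint fun C => compsOf (C \ P C) := by
    intro C hC C' hC' h
    rw [Function.onFun, Set.disjoint_left]
    intro A hA hA'
    obtain ⟨x, hx⟩ := nonempty_of_mem_compsOf hA
    exact Set.disjoint_left.1 (pairwiseDisjoint_compsOf Sᶜ hC hC' h)
      (subset_of_mem_compsOf hA hx).1 (subset_of_mem_compsOf hA' hx).1
  set Q := ⋃ C ∈ compsOf Sᶜ, P C with hQ
  have hQf : Q.Finite := hfin.biUnion hPf
  have hSQ : Disjoint S Q := by
    rw [hQ, disjoint_iUnion₂_right]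
    exact fun C hC => disjoint_compl_right.mono_right
      ((hPC C hC).trans (subset_of_mem_compsOf hC))
  have hcomps : compsOf (S ∪ Q)ᶜ = ⋃ C ∈ compsOf Sᶜ, compsOf (C \ P C) := by
    apply compsOf_eq_of_partition
    · intro A hA
      obtain ⟨C, hC, hAC⟩ := mem_iUnion₂.1 hA
      exact nonempty_of_mem_compsOf hAC
    · intro A hA
      obtain ⟨C, hC, hAC⟩ := mem_iUnion₂.1 hA
      exact isPreconnected_of_mem_compsOf hAC
    · intro A hA
      obtain ⟨C, hC, hAC⟩ := mem_iUnion₂.1 hA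
      exact isOpen_of_mem_compsOf ((hopen C hC).sdiff (hPf C hC).isClosed) (hPc C hC) hAC
    · intro A hA A' hA' h
      obtain ⟨C, hC, hAC⟩ := mem_iUnion₂.1 hA
      obtain ⟨C', hC', hAC'⟩ := mem_iUnion₂.1 hA'
      by_cases hCC' : C = C'
      · subst hCC'
        exact pairwiseDisjoint_compsOf _ hAC hAC' h
      · exact (pairwiseDisjoint_compsOf Sᶜ hC hC' hCC').mono
          ((subset_of_mem_compsOf hAC).trans sdiff_subset)
          ((subset_of_mem_compsOf hAC').trans sdiff_subset)
    · ext x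
      constructor
      · rintro ⟨A, hA, hxA⟩
        obtain ⟨C, hC, hAC⟩ := mem_iUnion₂.1 hA
        have hx := subset_of_mem_compsOf hAC hxA
        rintro (h | h)
        · exact subset_of_mem_compsOf hC hx.1 h
        · obtain ⟨C', hC', hxC'⟩ := mem_iUnion₂.1 h
          have : C' = C := by
            by_contra hne
            exact Set.disjoint_left.1 (pairwiseDisjoint_compsOf Sᶜ hC' hC hne)
              (hPC C' hC' hxC') hx.1
          exact hx.2 (this ▸ hxC')
      · intro hx
        rw [mem_compl_iff, mem_union, not_or] at hx
        obtain ⟨C, hC, hxC⟩ := (sUnion_compsOf Sᶜ).superset hx.1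
        have hxP : x ∈ C \ P C := ⟨hxC, fun h => hx.2 (mem_iUnion₂.2 ⟨C, hC, h⟩)⟩
        rw [← sUnion_compsOf (C \ P C)] at hxP
        obtain ⟨A, hA, hxA⟩ := hxP
        exact ⟨A, mem_iUnion₂.2 ⟨C, hC, hA⟩, hxA⟩
  have hEf : (compsOf (S ∪ Q)ᶜ).Finite := hcomps ▸ hfin.biUnion hPc
  have hWmodel : IsGraphModel (S ∪ Q) := by
    refine ⟨hS.union hQf, hEf, ?_⟩
    rw [hcomps]
    intro A hA
    obtain ⟨C, hC, hAC⟩ := mem_iUnion₂.1 hA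
    exact hPa C hC A hAC
  have hSsum : ∑ᶠ x ∈ S, ((val x : ℤ) - 1) = S.ncard := by
    rw [ncard_eq_finsum_mem hS]
    refine finsum_mem_congr rfl fun x hx => ?_
    rw [hV.valence_eq_two (Set.disjoint_left.1 hSV hx) (hval x)]
    norm_num
  have hcard : ((compsOf (S ∪ Q)ᶜ).ncard : ℤ) =
      ∑ᶠ C ∈ compsOf Sᶜ, ((compsOf (C \ P C)).ncard : ℤ) := by
    rw [ncard_eq_finsum_mem hEf, hcomps, finsum_mem_biUnion hEdis hfin hPc]
    exact finsum_mem_congr rfl fun C hC => (ncard_eq_finsum_mem (hPc C hC)).symm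
  rw [← hV₀, ← negEuler, IsGraphModel.negEuler_eq ⟨hV₀f, hV₀c, hV₀a⟩ hWmodel hval, negEuler,
    finsum_mem_union hSQ hS hQf, hSsum, hcard, hQ, finsum_mem_biUnion hPdis hfin hPf, add_sub_assoc,
    ← finsum_mem_sub_distrib _ _ hfin]
  congr 1
  exact finsum_mem_congr rfl hP

theorem deg_eq_add_sum_degOn {D : G → ℤ} (hD : FinSupp D) {S : Set G}
    (hS : S.Finite) (hfin : (compsOf Sᶜ).Finite) :
    deg D = (∑ᶠ x ∈ S, D x) + ∑ᶠ C ∈ compsOf Sᶜ, degOn C D := by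
  have hU : S ∪ ⋃ C ∈ compsOf Sᶜ, C ∩ support D = S ∪ (Sᶜ ∩ support D) := by
    rw [← iUnion₂_inter, ← sUnion_eq_biUnion, sUnion_compsOf]
  have hf : ∀ C ∈ compsOf Sᶜ, (C ∩ support D).Finite := fun C _ => hD.inter_of_right C
  have hdis : (compsOf Sᶜ).PairwiseDisjoint fun C => C ∩ support D :=
    (pairwiseDisjoint_compsOf Sᶜ).mono fun C => inter_subset_left
  have hdeg : deg D = ∑ᶠ x ∈ S ∪ ⋃ C ∈ compsOf Sᶜ, C ∩ support D, D x := by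
    rw [hU, deg, ← finsum_mem_univ]
    refine finsum_mem_inter_support_eq' _ _ _ fun x hx => ?_
    simp only [mem_univ, true_iff]
    by_cases h : x ∈ S
    · exact Or.inl h
    · exact Or.inr ⟨h, hx⟩
  rw [hdeg, finsum_mem_union _ hS (hfin.biUnion hf), finsum_mem_biUnion hdis hfin hf]
  · congr 1
    exact finsum_mem_congr rfl fun C _ => finsum_mem_inter_support D C
  · rw [disjoint_iUnion₂_right]
    exact fun C hC => disjoint_compl_right.mono_right
      (inter_subset_left.trans (subset_of_mem_compsOf hC))

/-! ### Isometric charts centred at interior points of edges -/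

/-- The ball of radius `r` around `x` is an interval centred at `x`, parametrized by `c`. -/
structure IsChart (c : ℝ → G) (x : G) (r : ℝ) : Prop where
  pos : 0 < r
  map_zero : c 0 = x
  isometricOn : IsometricOn c (-r) r
  image_eq : c '' Ioo (-r) r = Metric.ball x r

namespace IsChart

variable {c : ℝ → G} {x : G} {r : ℝ}

theorem dist_eq (h : IsChart c x r) {s : ℝ} (hs : |s| < r) : dist x (c s) = |s| := by
  have := h.isometricOn 0 ⟨by linarith [h.pos], h.pos⟩ s (abs_lt.1 hs)
  rwa [h.map_zero, zero_sub, abs_neg] at this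

theorem mem_ball (h : IsChart c x r) {s : ℝ} (hs : |s| < r) : c s ∈ Metric.ball x r := by
  rw [Metric.mem_ball, dist_comm, h.dist_eq hs]
  exact hs

theorem exists_eq (h : IsChart c x r) {y : G} (hy : dist x y < r) :
    ∃ s, c s = y ∧ |s| = dist x y ∧ |s| < r := by
  rw [dist_comm, ← Metric.mem_ball, ← h.image_eq] at hy
  obtain ⟨s, hs, rfl⟩ := hy
  exact ⟨s, rfl, (h.dist_eq (abs_lt.2 hs)).symm, abs_lt.2 hs⟩

theorem mono (h : IsChart c x r) {r' : ℝ} (hr' : 0 < r') (hle : r' ≤ r) : IsChart c x r' := by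
  refine ⟨hr', h.map_zero, h.isometricOn.mono (neg_le_neg hle) hle, ?_⟩
  ext y
  constructor
  · rintro ⟨s, hs, rfl⟩
    have hs' := abs_lt.2 hs
    rw [Metric.mem_ball, dist_comm, h.dist_eq (hs'.trans_le hle)]
    exact hs'
  · intro hy
    rw [Metric.mem_ball, dist_comm] at hy
    obtain ⟨s, rfl, hs, -⟩ := h.exists_eq (hy.trans_le hle)
    exact ⟨s, abs_lt.1 (hs ▸ hy), rfl⟩

theorem reverse (h : IsChart c x r) : IsChart (fun t => c (-t)) x r := by
  refine ⟨h.pos, by rw [neg_zero, h.map_zero], fun s hs t ht => ?_, ?_⟩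
  · rw [h.isometricOn _ ⟨by linarith [hs.2], by linarith [hs.1]⟩ _
      ⟨by linarith [ht.2], by linarith [ht.1]⟩, ← abs_neg]
    congr 1
    ring
  · rw [← h.image_eq, ← image_image c (fun t => -t)]
    simp

theorem recenter (h : IsChart c x r) {s : ℝ} (hs : |s| < r) :
    IsChart (fun t => c (s + t)) (c s) (r - |s|) := by
  have hmem : ∀ t : ℝ, |t| < r - |s| → s + t ∈ Ioo (-r) r := fun t ht =>
    abs_lt.1 ((abs_add_le s t).trans_lt (by linarith))
  refine ⟨by linarith, by rw [add_zero], fun t ht u hu => ?_, ?_⟩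
  · rw [h.isometricOn _ (hmem t (abs_lt.2 ht)) _ (hmem u (abs_lt.2 hu))]
    congr 1
    ring
  · ext y
    constructor
    · rintro ⟨t, ht, rfl⟩
      rw [Metric.mem_ball, h.isometricOn _ (hmem t (abs_lt.2 ht)) _ (abs_lt.1 hs),
        add_sub_cancel_left]
      exact abs_lt.2 ht
    · intro hy
      rw [Metric.mem_ball] at hy
      have hxy : dist x y < r := by
        have := dist_triangle_right x y (c s)
        rw [h.dist_eq hs] at this
        linarith
      obtain ⟨u, rfl, -, hu⟩ := h.exists_eq hxy
      rw [h.isometricOn _ (abs_lt.1 hu) _ (abs_lt.1 hs)] at hy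
      exact ⟨u - s, abs_lt.1 hy, by simp⟩

theorem isUnitSpeedFrom (h : IsChart c x r) : IsUnitSpeedFrom x r c :=
  ⟨h.map_zero, fun s hs t ht => h.isometricOn s ⟨by linarith [hs.1, h.pos], hs.2⟩ t
    ⟨by linarith [ht.1, h.pos], ht.2⟩⟩

/-- Near its starting point, a unit speed path follows the chart in one of its directions. -/
theorem eq_or_eq_reverse (h : IsChart c x r) {u : ℝ → G} {ε : ℝ} (hε : 0 < ε)
    (hu : IsUnitSpeedFrom x ε u) :
    ∃ δ > (0 : ℝ), (∀ t ∈ Ico (0 : ℝ) δ, u t = c t) ∨ ∀ t ∈ Ico (0 : ℝ) δ, u t = c (-t) := by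
  have hw : ∀ t ∈ Ico (0 : ℝ) (min ε r), u t = c t ∨ u t = c (-t) := by
    intro t ht
    have hd := hu.2 0 ⟨le_rfl, hε⟩ t ⟨ht.1, ht.2.trans_le (min_le_left _ _)⟩
    rw [hu.1, zero_sub, abs_neg, abs_of_nonneg ht.1] at hd
    obtain ⟨s, hs, hst, -⟩ := h.exists_eq (hd.trans_lt (ht.2.trans_le (min_le_right _ _)))
    rw [hd] at hst
    rcases (abs_eq ht.1).1 hst with rfl | rfl
    · exact Or.inl hs.symm
    · exact Or.inr hs.symm
  refine ⟨min ε r, lt_min hε h.pos, ?_⟩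
  by_contra! hcon
  obtain ⟨⟨t, ht, hut⟩, ⟨s, hs, hus⟩⟩ := hcon
  have hut' := (hw t ht).resolve_left hut
  have hus' := (hw s hs).resolve_right hus
  have hs0 : 0 < s := lt_of_le_of_ne hs.1 fun h0 => hus (by rw [hus', ← h0, neg_zero])
  have ht0 : 0 < t := lt_of_le_of_ne ht.1 fun h0 => hut (by rw [hut', ← h0, neg_zero])
  have htr := ht.2.trans_le (min_le_right ε r)
  have hsr := hs.2.trans_le (min_le_right ε r)
  have hd := hu.2 t ⟨ht.1, ht.2.trans_le (min_le_left _ _)⟩ s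
    ⟨hs.1, hs.2.trans_le (min_le_left _ _)⟩
  rw [hut', hus', h.isometricOn _ ⟨by linarith, by linarith⟩ _ ⟨by linarith, hsr⟩,
    abs_of_neg (by linarith)] at hd
  rcases abs_cases (t - s) with h' | h' <;> linarith [h'.1]

end IsChart

theorem IsGraphModel.exists_chart {V : Set G} (hV : IsGraphModel V) {x : G} (hx : x ∉ V)
    {U : Set G} (hU : U ∈ nhds x) : ∃ c r, IsChart c x r ∧ Metric.ball x r ⊆ U := by
  obtain ⟨c, a, b, t, ht, rfl, hiso, hop, -⟩ := hV.exists_arc hx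
  obtain ⟨r₁, hr₁, hball₁⟩ := Metric.isOpen_iff.1 hop _ (mem_image_of_mem c ht)
  obtain ⟨r₂, hr₂, hball₂⟩ := Metric.mem_nhds_iff.1 hU
  obtain ⟨r, hr, hlt⟩ := exists_between
    (lt_min (lt_min hr₁ hr₂) (lt_min (sub_pos.2 ht.1) (sub_pos.2 ht.2)))
  rw [lt_min_iff, lt_min_iff, lt_min_iff] at hlt
  have hmem : ∀ s ∈ Ioo (-r) r, t + s ∈ Ioo a b := fun s hs =>
    ⟨by linarith [hs.1], by linarith [hs.2]⟩
  refine ⟨fun s => c (t + s), r, ⟨hr, by rw [add_zero], fun s hs u hu => ?_, ?_⟩,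
    (Metric.ball_subset_ball hlt.1.2.le).trans hball₂⟩
  · rw [hiso _ (hmem s hs) _ (hmem u hu), add_sub_add_left_eq_sub]
  · ext y
    constructor
    · rintro ⟨s, hs, rfl⟩
      rw [Metric.mem_ball, hiso _ (hmem s hs) _ ht, add_sub_cancel_left]
      exact abs_lt.2 hs
    · intro hy
      obtain ⟨u, hu, rfl⟩ := hball₁ (Metric.ball_subset_ball hlt.1.1.le hy)
      rw [Metric.mem_ball, hiso _ hu _ ht] at hy
      exact ⟨u - t, abs_lt.1 hy, by simp⟩

/-! ### Slopes and orders of rational functions -/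

theorem HasSlopeAlong.congr {X : Type*} {f : X → ℝ} {u w : ℝ → X} {s : ℤ}
    (h : HasSlopeAlong f u s) {δ : ℝ} (hδ : 0 < δ) (huw : ∀ t ∈ Ico (0 : ℝ) δ, w t = u t) : HasSlopeAlong f w s := by
  obtain ⟨η, hη, hs⟩ := h
  refine ⟨min η δ, lt_min hη hδ, fun t ht => ?_⟩
  rw [huw t ⟨ht.1, ht.2.trans_le (min_le_right _ _)⟩, huw 0 ⟨le_rfl, hδ⟩]
  exact hs t ⟨ht.1, ht.2.trans_le (min_le_left _ _)⟩

theorem HasSlopeAlong.unique {X : Type*} {f : X → ℝ} {u : ℝ → X} {s s' : ℤ}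
    (h : HasSlopeAlong f u s) (h' : HasSlopeAlong f u s') : s = s' := by
  obtain ⟨η, hη, hs⟩ := h
  obtain ⟨η', hη', hs'⟩ := h'
  obtain ⟨t, ht, htη⟩ := exists_between (lt_min hη hη')
  have h₁ := hs t ⟨ht.le, htη.trans_le (min_le_left _ _)⟩
  have h₂ := hs' t ⟨ht.le, htη.trans_le (min_le_right _ _)⟩
  have : (s : ℝ) * t = s' * t := by linarith
  exact_mod_cast mul_right_cancel₀ ht.ne' this

theorem HasSlopeAlong.add {X : Type*} {f k : X → ℝ} {u : ℝ → X} {s s' : ℤ}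
    (h : HasSlopeAlong f u s) (h' : HasSlopeAlong k u s') :
    HasSlopeAlong (fun x => f x + k x) u (s + s') := by
  obtain ⟨η, hη, hs⟩ := h
  obtain ⟨η', hη', hs'⟩ := h'
  refine ⟨min η η', lt_min hη hη', fun t ht => ?_⟩
  simp only [hs t ⟨ht.1, ht.2.trans_le (min_le_left _ _)⟩,
    hs' t ⟨ht.1, ht.2.trans_le (min_le_right _ _)⟩]
  push_cast
  ring

theorem HasSlopeAlong.sub {X : Type*} {f k : X → ℝ} {u : ℝ → X} {s s' : ℤ}
    (h : HasSlopeAlong f u s) (h' : HasSlopeAlong k u s') :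
    HasSlopeAlong (fun x => f x - k x) u (s - s') := by
  obtain ⟨η, hη, hs⟩ := h
  obtain ⟨η', hη', hs'⟩ := h'
  refine ⟨min η η', lt_min hη hη', fun t ht => ?_⟩
  simp only [hs t ⟨ht.1, ht.2.trans_le (min_le_left _ _)⟩,
    hs' t ⟨ht.1, ht.2.trans_le (min_le_right _ _)⟩]
  push_cast
  ring

theorem IsRational.add {f k : G → ℝ} (hf : IsRational f) (hk : IsRational k) :
    IsRational fun x => f x + k x := by
  refine ⟨hf.1.add hk.1, fun x ε u hε hu => ?_⟩
  obtain ⟨s, hs⟩ := hf.2 x ε u hε hu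
  obtain ⟨s', hs'⟩ := hk.2 x ε u hε hu
  exact ⟨_, hs.add hs'⟩

theorem IsRational.sub {f k : G → ℝ} (hf : IsRational f) (hk : IsRational k) :
    IsRational fun x => f x - k x := by
  refine ⟨hf.1.sub hk.1, fun x ε u hε hu => ?_⟩
  obtain ⟨s, hs⟩ := hf.2 x ε u hε hu
  obtain ⟨s', hs'⟩ := hk.2 x ε u hε hu
  exact ⟨_, hs.sub hs'⟩

theorem tangentSlope_eq_of_out {f : G → ℝ} {x : G} {ζ : TangentDir x} {s : ℤ}
    (h : HasSlopeAlong f (Quotient.out ζ).1 s) : tangentSlope f ζ = s := by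
  have hex : ∃ s : ℤ, HasSlopeAlong f (Quotient.out ζ).1 s := ⟨s, h⟩
  rw [tangentSlope, dif_pos hex]
  exact hex.choose_spec.unique h

theorem tangentSlope_mk {f : G → ℝ} {x : G} {u : UnitPath x} {s : ℤ}
    (h : HasSlopeAlong f u.1 s) :
    tangentSlope f (Quotient.mk (germSetoid x) u : TangentDir x) = s := by
  obtain ⟨δ, hδ, hout⟩ := Quotient.mk_out (s := germSetoid x) u
  exact tangentSlope_eq_of_out (h.congr hδ hout)

theorem IsRational.hasSlopeAlong_tangentSlope {f : G → ℝ} (hf : IsRational f) {x : G}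
    (ζ : TangentDir x) : HasSlopeAlong f (Quotient.out ζ).1 (tangentSlope f ζ) := by
  obtain ⟨ε, hε, hu⟩ := (Quotient.out ζ).2
  obtain ⟨s, hs⟩ := hf.2 x ε _ hε hu
  rwa [tangentSlope_eq_of_out hs]

theorem ordAt_eq_zero {f : G → ℝ} {x : G} (h : ∀ ζ : TangentDir x, tangentSlope f ζ = 0) :
    ordAt f x = 0 := by
  simp [ordAt, h]

theorem IsChart.ordAt_eq {c : ℝ → G} {x : G} {r : ℝ} (h : IsChart c x r) {f : G → ℝ} {s s' : ℤ}
    (hs : HasSlopeAlong f c s) (hs' : HasSlopeAlong f (fun t => c (-t)) s') :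
    ordAt f x = s + s' := by
  let ζ : TangentDir x := Quotient.mk (germSetoid x) ⟨c, r, h.pos, h.isUnitSpeedFrom⟩
  let ζ' : TangentDir x := Quotient.mk (germSetoid x)
    ⟨fun t => c (-t), r, h.pos, h.reverse.isUnitSpeedFrom⟩
  have hne : ζ ≠ ζ' := by
    intro heq
    obtain ⟨δ, hδ, hcc⟩ := Quotient.exact heq
    obtain ⟨t, ht, htδ⟩ := exists_between (lt_min hδ h.pos)
    rw [lt_min_iff] at htδ
    have := h.isometricOn.injOn ⟨by linarith [h.pos], htδ.2⟩ ⟨by linarith, by linarith [h.pos]⟩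
      (hcc t ⟨ht.le, htδ.1⟩)
    linarith
  have huniv : (univ : Set (TangentDir x)) = {ζ, ζ'} := by
    refine (eq_univ_of_forall fun ξ => ?_).symm
    induction ξ using Quotient.inductionOn with
    | h u =>
      obtain ⟨ε, hε, hu⟩ := u.2
      obtain ⟨δ, hδ, h₁ | h₁⟩ := h.eq_or_eq_reverse hε hu
      · exact Or.inl (Quotient.sound ⟨δ, hδ, h₁⟩)
      · exact Or.inr (Quotient.sound ⟨δ, hδ, h₁⟩)
  rw [ordAt, ← finsum_mem_univ, huniv, finsum_mem_pair hne]
  exact congrArg₂ (· + ·) (tangentSlope_mk hs) (tangentSlope_mk hs')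

theorem IsChart.ordAt_add {c : ℝ → G} {x : G} {r : ℝ} (h : IsChart c x r) {f k : G → ℝ}
    (hf : IsRational f) (hk : IsRational k) :
    ordAt (fun y => f y + k y) x = ordAt f x + ordAt k x := by
  obtain ⟨s₁, h₁⟩ := hf.2 x r _ h.pos h.isUnitSpeedFrom
  obtain ⟨s₂, h₂⟩ := hf.2 x r _ h.pos h.reverse.isUnitSpeedFrom
  obtain ⟨s₃, h₃⟩ := hk.2 x r _ h.pos h.isUnitSpeedFrom
  obtain ⟨s₄, h₄⟩ := hk.2 x r _ h.pos h.reverse.isUnitSpeedFrom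
  rw [h.ordAt_eq h₁ h₂, h.ordAt_eq h₃ h₄, h.ordAt_eq (h₁.add h₃) (h₂.add h₄)]
  ring

theorem IsChart.ordAt_sub {c : ℝ → G} {x : G} {r : ℝ} (h : IsChart c x r) {f k : G → ℝ}
    (hf : IsRational f) (hk : IsRational k) :
    ordAt (fun y => f y - k y) x = ordAt f x - ordAt k x := by
  obtain ⟨s₁, h₁⟩ := hf.2 x r _ h.pos h.isUnitSpeedFrom
  obtain ⟨s₂, h₂⟩ := hf.2 x r _ h.pos h.reverse.isUnitSpeedFrom
  obtain ⟨s₃, h₃⟩ := hk.2 x r _ h.pos h.isUnitSpeedFrom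
  obtain ⟨s₄, h₄⟩ := hk.2 x r _ h.pos h.reverse.isUnitSpeedFrom
  rw [h.ordAt_eq h₁ h₂, h.ordAt_eq h₃ h₄, h.ordAt_eq (h₁.sub h₃) (h₂.sub h₄)]
  ring

theorem IsRational.tangentSlope_add {f k : G → ℝ} (hf : IsRational f) (hk : IsRational k) {x : G}
    (ζ : TangentDir x) :
    tangentSlope (fun y => f y + k y) ζ = tangentSlope f ζ + tangentSlope k ζ :=
  tangentSlope_eq_of_out
    ((hf.hasSlopeAlong_tangentSlope ζ).add (hk.hasSlopeAlong_tangentSlope ζ))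

theorem IsRational.tangentSlope_sub {f k : G → ℝ} (hf : IsRational f) (hk : IsRational k) {x : G}
    (ζ : TangentDir x) :
    tangentSlope (fun y => f y - k y) ζ = tangentSlope f ζ - tangentSlope k ζ :=
  tangentSlope_eq_of_out
    ((hf.hasSlopeAlong_tangentSlope ζ).sub (hk.hasSlopeAlong_tangentSlope ζ))

/-! ### Tent functions -/

/-- The tent function of height `δ` with apex `p`. -/
noncomputable def tent (p : G) (δ : ℝ) : G → ℝ :=
  fun y => max (δ - dist p y) 0

/-- The right derivative of `s ↦ max (δ - |s|) 0`. -/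
noncomputable def tentSlope (δ s : ℝ) : ℤ :=
  if s < -δ then 0 else if s < 0 then 1 else if s < δ then -1 else 0

theorem max_sub_abs_eq {δ : ℝ} (hδ : 0 < δ) (s : ℝ) : ∃ η > (0 : ℝ), ∀ t ∈ Ico (0 : ℝ) η,
    max (δ - |s + t|) 0 = max (δ - |s|) 0 + tentSlope δ s * t := by
  unfold tentSlope
  split_ifs with h₁ h₂ h₃
  · refine ⟨-δ - s, by linarith, fun t ht => ?_⟩
    rw [abs_of_neg (by linarith [ht.2]), abs_of_neg (by linarith),
      max_eq_right (by linarith [ht.2]), max_eq_right (by linarith)]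
    simp
  · refine ⟨-s, by linarith, fun t ht => ?_⟩
    rw [abs_of_neg (by linarith [ht.2]), abs_of_neg h₂, max_eq_left (by linarith [ht.1]),
      max_eq_left (by linarith)]
    push_cast
    ring
  · refine ⟨δ - s, by linarith, fun t ht => ?_⟩
    rw [abs_of_nonneg (by linarith [ht.1]), abs_of_nonneg (by linarith),
      max_eq_left (by linarith [ht.2]), max_eq_left (by linarith)]
    push_cast
    ring
  · refine ⟨1, one_pos, fun t ht => ?_⟩
    rw [abs_of_nonneg (by linarith [ht.1]), abs_of_nonneg (by linarith),
      max_eq_right (by linarith [ht.1]), max_eq_right (by linarith)]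
    simp

theorem hasSlopeAlong_tent_of_lt_dist {p x : G} {δ ε : ℝ} (hx : δ < dist p x) (hε : 0 < ε)
    {u : ℝ → G} (hu : IsUnitSpeedFrom x ε u) : HasSlopeAlong (tent p δ) u 0 := by
  refine ⟨min ε (dist p x - δ), lt_min hε (sub_pos.2 hx), fun t ht => ?_⟩
  have hd := hu.2 0 ⟨le_rfl, hε⟩ t ⟨ht.1, ht.2.trans_le (min_le_left _ _)⟩
  rw [hu.1, zero_sub, abs_neg, abs_of_nonneg ht.1] at hd
  have htr := dist_triangle_right p x (u t)
  have htl := ht.2.trans_le (min_le_right ε (dist p x - δ))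
  rw [hu.1, tent, tent, max_eq_right (by linarith), max_eq_right (by linarith)]
  simp

theorem IsChart.hasSlopeAlong_tent {c : ℝ → G} {p : G} {r δ s : ℝ} (h : IsChart c p r)
    (hδ : 0 < δ) (hs : |s| < r) :
    HasSlopeAlong (tent p δ) (fun t => c (s + t)) (tentSlope δ s) := by
  obtain ⟨η, hη, hmax⟩ := max_sub_abs_eq hδ s
  refine ⟨min η (r - |s|), lt_min hη (sub_pos.2 hs), fun t ht => ?_⟩
  have h₁ : |s + t| < r := by
    have := ht.2.trans_le (min_le_right η (r - |s|))
    have h₂ := abs_add_le s t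
    rw [abs_of_nonneg ht.1] at h₂
    linarith
  rw [tent, h.dist_eq h₁, hmax t ⟨ht.1, ht.2.trans_le (min_le_left _ _)⟩, tent]
  simp only [add_zero, h.dist_eq hs]

theorem IsChart.hasSlopeAlong_tent_reverse {c : ℝ → G} {p : G} {r δ s : ℝ} (h : IsChart c p r)
    (hδ : 0 < δ) (hs : |s| < r) :
    HasSlopeAlong (tent p δ) (fun t => c (s + -t)) (tentSlope δ (-s)) := by
  convert h.reverse.hasSlopeAlong_tent hδ (s := -s) (by rwa [abs_neg]) using 2
  congr 1
  ring

theorem IsChart.ordAt_tent {c : ℝ → G} {p : G} {r δ s : ℝ} (h : IsChart c p r)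
    (hδ : 0 < δ) (hs : |s| < r) :
    ordAt (tent p δ) (c s) = tentSlope δ s + tentSlope δ (-s) :=
  (h.recenter hs).ordAt_eq (h.hasSlopeAlong_tent hδ hs) (h.hasSlopeAlong_tent_reverse hδ hs)

theorem continuous_tent (p : G) (δ : ℝ) : Continuous (tent p δ) := by
  unfold tent
  fun_prop

theorem IsChart.isRational_tent {c : ℝ → G} {p : G} {r δ : ℝ} (h : IsChart c p r)
    (hδ : 0 < δ) (hδr : δ < r) : IsRational (tent p δ) := by
  refine ⟨continuous_tent p δ, fun x ε u hε hu => ?_⟩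
  by_cases hx : dist p x < r
  · obtain ⟨s, rfl, -, hs⟩ := h.exists_eq hx
    obtain ⟨η, hη, h₁ | h₁⟩ := (h.recenter hs).eq_or_eq_reverse hε hu
    · exact ⟨_, (h.hasSlopeAlong_tent hδ hs).congr hη h₁⟩
    · exact ⟨_, (h.hasSlopeAlong_tent_reverse hδ hs).congr hη h₁⟩
  · exact ⟨0, hasSlopeAlong_tent_of_lt_dist (by linarith) hε hu⟩

theorem tangentSlope_tent_of_lt_dist {p x : G} {δ : ℝ} (hx : δ < dist p x) (ζ : TangentDir x) :
    tangentSlope (tent p δ) ζ = 0 := by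
  obtain ⟨ε, hε, hu⟩ := (Quotient.out ζ).2
  exact tangentSlope_eq_of_out (hasSlopeAlong_tent_of_lt_dist hx hε hu)

theorem IsChart.ordAt_tent_apex {c : ℝ → G} {p : G} {r δ : ℝ} (h : IsChart c p r)
    (hδ : 0 < δ) : ordAt (tent p δ) p = -2 := by
  have := h.ordAt_tent hδ (s := 0) (by simpa using h.pos)
  rw [h.map_zero] at this
  rw [this, neg_zero, tentSlope, if_neg (by linarith), if_neg (lt_irrefl _), if_pos hδ]
  norm_num

theorem IsChart.ordAt_tent_foot {c : ℝ → G} {p : G} {r δ : ℝ} (h : IsChart c p r)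
    (hδ : 0 < δ) (hδr : δ < r) : ordAt (tent p δ) (c δ) = 1 := by
  rw [h.ordAt_tent hδ (by rwa [abs_of_pos hδ]), tentSlope, tentSlope, if_neg (by linarith),
    if_neg (by linarith), if_neg (lt_irrefl _), if_neg (lt_irrefl _), if_pos (by linarith)]
  norm_num

theorem IsChart.ordAt_tent_of_ne {c : ℝ → G} {p : G} {r δ : ℝ} (h : IsChart c p r)
    (hδ : 0 < δ) (hδr : δ < r) {x : G} (h₀ : x ≠ p) (h₁ : x ≠ c δ) (h₂ : x ≠ c (-δ)) :
    ordAt (tent p δ) x = 0 := by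
  by_cases hx : dist p x < r
  · obtain ⟨s, rfl, -, hs⟩ := h.exists_eq hx
    have h₀' : s ≠ 0 := fun hs => h₀ (by rw [hs, h.map_zero])
    have h₁' : s ≠ δ := fun hs => h₁ (by rw [hs])
    have h₂' : s ≠ -δ := fun hs => h₂ (by rw [hs])
    rw [h.ordAt_tent hδ hs, tentSlope, tentSlope]
    split_ifs <;> first | rfl | (exfalso; grind)
  · exact ordAt_eq_zero fun ζ => tangentSlope_tent_of_lt_dist (by linarith) ζ

/-! ### Oscillation of rational functions near chips -/

theorem sub_le_osc [CompactSpace G] {f : G → ℝ} (hf : Continuous f) (x y : G) :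
    f x - f y ≤ osc f :=
  sub_le_sub (le_csSup (isCompact_range hf).bddAbove (mem_range_self x))
    (csInf_le (isCompact_range hf).bddBelow (mem_range_self y))

theorem osc_nonneg (f : G → ℝ) [CompactSpace G] [Nonempty G] (hf : Continuous f) : 0 ≤ osc f := by
  have := sub_le_osc hf (Classical.arbitrary G) (Classical.arbitrary G)
  rwa [sub_self] at this

theorem osc_tent_le (p : G) {δ : ℝ} (hδ : 0 ≤ δ) : osc (tent p δ) ≤ δ := by
  have hne : (range (tent p δ)).Nonempty := ⟨_, mem_range_self p⟩
  have h₁ : sSup (range (tent p δ)) ≤ δ := csSup_le hne (by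
    rintro _ ⟨y, rfl⟩
    exact max_le (by linarith [dist_nonneg (x := p) (y := y)]) hδ)
  have h₂ : 0 ≤ sInf (range (tent p δ)) := le_csInf hne (by
    rintro _ ⟨y, rfl⟩
    exact le_max_right _ _)
  rw [osc]
  linarith

theorem linDist_le [CompactSpace G] [Nonempty G] {D₁ D₂ : G → ℤ} {f : G → ℝ} (hf : IsRational f)
    (h : ∀ x, D₂ x = D₁ x + ordAt f x) : linDist D₁ D₂ ≤ osc f := by
  refine csInf_le ⟨0, ?_⟩ ⟨f, hf, h, rfl⟩
  rintro _ ⟨k, hk, -, rfl⟩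
  exact osc_nonneg k hk.1

/-- A function that is affine near every point of an open interval is affine on it. -/
theorem exists_eq_affine_of_locally {k : ℝ → ℝ} {a b : ℝ}
    (h : ∀ t ∈ Ioo a b, ∃ s : ℝ, ∀ᶠ u in nhds t, k u = k t + s * (u - t)) :
    ∃ s : ℝ, ∀ t ∈ Ioo a b, ∀ u ∈ Ioo a b, k u = k t + s * (u - t) := by
  have hderiv : ∀ (t s k₀ : ℝ) (f : ℝ → ℝ), (∀ᶠ u in nhds t, f u = k₀ + s * (u - t)) →
      ∀ᶠ u in nhds t, HasDerivAt f s u := by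
    intro t s k₀ f hs
    filter_upwards [hs.eventually_nhds] with u hu
    refine HasDerivAt.congr_of_eventuallyEq ?_ hu
    simpa using (((hasDerivAt_id u).sub_const t).const_mul s).const_add k₀
  have h₁ : ∀ t ∈ Ioo a b, ∃ s : ℝ, ∀ᶠ u in nhds t, HasDerivAt k s u := fun t ht =>
    (h t ht).imp fun s hs => hderiv t s _ k hs
  have h₂ : ∀ t ∈ Ioo a b, HasDerivAt (deriv k) 0 t := by
    intro t ht
    obtain ⟨s, hs⟩ := h₁ t ht
    exact (hasDerivAt_const t s).congr_of_eventuallyEq (hs.mono fun u hu => hu.deriv)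
  have h₃ : ∀ t ∈ Ioo a b, ∀ u ∈ Ioo a b, deriv k t = deriv k u := fun t ht u hu =>
    isOpen_Ioo.is_const_of_deriv_eq_zero isPreconnected_Ioo
      (fun w hw => (h₂ w hw).differentiableAt.differentiableWithinAt)
      (fun w hw => (h₂ w hw).deriv) ht hu
  by_cases hab : (Ioo a b).Nonempty
  · obtain ⟨m, hm⟩ := hab
    refine ⟨deriv k m, fun t ht u hu => ?_⟩
    have h₄ : ∀ w ∈ Ioo a b, HasDerivAt (fun w => k w - deriv k m * w) 0 w := by
      intro w hw
      obtain ⟨s, hs⟩ := h₁ w hw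
      have hs' := hs.self_of_nhds
      have := hs'.sub ((hasDerivAt_id w).const_mul (deriv k m))
      rwa [h₃ m hm w hw, hs'.deriv, mul_one, sub_self, ← hs'.deriv, ← h₃ m hm w hw] at this
    have h₅ := isOpen_Ioo.is_const_of_deriv_eq_zero isPreconnected_Ioo
      (fun w hw => (h₄ w hw).differentiableAt.differentiableWithinAt)
      (fun w hw => (h₄ w hw).deriv) ht hu
    linarith
  · exact ⟨0, fun t ht => absurd ⟨t, ht⟩ hab⟩

theorem IsChart.eq_affine {c : ℝ → G} {q : G} {r : ℝ} (h : IsChart c q r) {f : G → ℝ}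
    (hf : IsRational f) {s : ℤ} (hs : HasSlopeAlong f c s)
    (h₀ : ∀ t ∈ Ioo 0 r, ordAt f (c t) = 0) {t : ℝ} (ht : t ∈ Ioo 0 r) :
    f (c t) = f q + s * t := by
  obtain ⟨m, hm⟩ := exists_eq_affine_of_locally (k := fun t => f (c t)) (a := 0) (b := r) (by
    intro t ht
    have htr : |t| < r := by rw [abs_of_pos ht.1]; exact ht.2
    have hc := h.recenter htr
    obtain ⟨s₁, h₁⟩ := hf.2 _ _ _ hc.pos hc.isUnitSpeedFrom
    obtain ⟨s₂, h₂⟩ := hf.2 _ _ _ hc.pos hc.reverse.isUnitSpeedFrom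
    have hsum := hc.ordAt_eq h₁ h₂
    rw [h₀ t ht] at hsum
    have hs₂ : s₂ = -s₁ := by linarith
    subst hs₂
    obtain ⟨δ₁, hδ₁, h₁⟩ := h₁
    obtain ⟨δ₂, hδ₂, h₂⟩ := h₂
    refine ⟨s₁, ?_⟩
    filter_upwards [Ioo_mem_nhds (show t - δ₂ < t by linarith) (show t < t + δ₁ by linarith)]
      with u hu
    rcases le_total t u with htu | htu
    · have := h₁ (u - t) ⟨by linarith, by linarith [hu.2]⟩
      simpa using this
    · have := h₂ (t - u) ⟨by linarith, by linarith [hu.1]⟩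
      simp only [neg_sub, add_sub_cancel, neg_zero, add_zero, Int.cast_neg] at this
      rw [this]
      ring)
  obtain ⟨δ, hδ, hs⟩ := hs
  rw [h.map_zero] at hs
  obtain ⟨w, hw₀, hw⟩ := exists_between (lt_min hδ h.pos)
  obtain ⟨w', hw₀', hw'⟩ := exists_between hw₀
  rw [lt_min_iff] at hw
  have e₁ := hs w ⟨hw₀.le, hw.1⟩
  have e₂ := hs w' ⟨hw₀'.le, hw'.trans hw.1⟩
  have e₃ := hm w ⟨hw₀, hw.2⟩ w' ⟨hw₀', hw'.trans hw.2⟩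
  have e₄ := hm w ⟨hw₀, hw.2⟩ t ht
  have hms : m = s := by
    have : (m - s) * (w' - w) = 0 := by linarith
    rcases mul_eq_zero.1 this with h' | h' <;> linarith
  rw [e₄, e₁, hms]
  ring

/-- A rational function with an isolated strictly concave bend has large oscillation. -/
theorem IsChart.half_le_osc [CompactSpace G] {c : ℝ → G} {q : G} {r : ℝ} (h : IsChart c q r)
    {f : G → ℝ} (hf : IsRational f) (hq : ordAt f q < 0)
    (h₀ : ∀ x ∈ Metric.ball q r, x ≠ q → ordAt f x = 0) : r / 2 ≤ osc f := by
  have key : ∀ c' : ℝ → G, IsChart c' q r → ∀ s : ℤ, HasSlopeAlong f c' s → s < 0 →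
      r / 2 ≤ osc f := by
    intro c' hc s hs hs0
    have hr : r / 2 ∈ Ioo 0 r := ⟨half_pos hc.pos, half_lt_self hc.pos⟩
    have he := hc.eq_affine hf hs (fun t ht => h₀ _
      (hc.mem_ball (by rw [abs_of_pos ht.1]; exact ht.2)) (fun heq => by
        have := hc.dist_eq (s := t) (by rw [abs_of_pos ht.1]; exact ht.2)
        rw [heq, dist_self, abs_of_pos ht.1] at this
        exact ht.1.ne this)) hr
    have hle := sub_le_osc hf.1 q (c' (r / 2))
    have hs1 : (s : ℝ) ≤ -1 := by exact_mod_cast (by omega : s ≤ -1)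
    nlinarith [hr.1]
  obtain ⟨s, hs⟩ := hf.2 q r _ h.pos h.isUnitSpeedFrom
  obtain ⟨s', hs'⟩ := hf.2 q r _ h.pos h.reverse.isUnitSpeedFrom
  rw [h.ordAt_eq hs hs'] at hq
  by_cases hs0 : s < 0
  · exact key c h s hs hs0
  · exact key _ h.reverse s' hs' (by omega)


/-! ### Chips of generic divisors inside the edges -/

theorem FinSupp.exists_chart {V : Set G} (hV : IsGraphModel V) {D : G → ℤ} (hD : FinSupp D)
    {q : G} (hq : q ∉ V) :
    ∃ c r, IsChart c q r ∧ ∀ y ∈ Metric.ball q r, y ∉ V ∧ (D y ≠ 0 → y = q) := by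
  have hU : Vᶜ ∩ (support D \ {q})ᶜ ∈ nhds q :=
    Filter.inter_mem (hV.1.isClosed.isOpen_compl.mem_nhds hq)
      ((hD.sdiff).isClosed.isOpen_compl.mem_nhds fun h => h.2 rfl)
  obtain ⟨c, r, h, hsub⟩ := hV.exists_chart hq hU
  refine ⟨c, r, h, fun y hy => ⟨(hsub hy).1, fun hDy => ?_⟩⟩
  by_contra hne
  exact (hsub hy).2 ⟨hDy, hne⟩

/-- The number of points in the edges carrying chips is lower semicontinuous. -/
theorem ncard_edgeSupp_le_of_linDist_lt [CompactSpace G] {V : Set G} (hV : IsGraphModel V)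
    {D : G → ℤ} (hD : FinSupp D) (hDe : Effective D) :
    ∃ η > (0 : ℝ), ∀ D' : G → ℤ, LinEquiv D D' → (edgeSupp V D').Finite → linDist D D' < η →
      (edgeSupp V D).ncard ≤ (edgeSupp V D').ncard := by
  have hS : (edgeSupp V D).Finite := hD.subset fun x hx => hx.2
  have hev : ∀ q ∈ edgeSupp V D, ∀ᶠ η in nhdsWithin (0 : ℝ) (Ioi 0),
      (∃ c, IsChart c q η) ∧ ∀ y ∈ Metric.ball q (2 * η), y ∉ V ∧ (D y ≠ 0 → y = q) := by
    intro q hq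
    obtain ⟨c, r, h, hr⟩ := hD.exists_chart hV hq.1
    filter_upwards [Ioo_mem_nhdsGT (half_pos h.pos)] with η hη
    exact ⟨⟨c, h.mono hη.1 (by linarith [hη.2, h.pos])⟩, fun y hy =>
      hr y (Metric.ball_subset_ball (by linarith [hη.2]) hy)⟩
  obtain ⟨η, hη, hη₀⟩ :=
    (((Filter.eventually_all_finite hS).2 hev).and self_mem_nhdsWithin).exists
  have hη₀ : 0 < η := hη₀
  refine ⟨η / 2, half_pos hη₀, fun D' hD' hfin hlt => ?_⟩
  obtain ⟨f₀, hf₀, hD'⟩ := hD'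
  obtain ⟨_, ⟨f, hf, hDf, rfl⟩, hosc⟩ := exists_lt_of_csInf_lt (by exact ⟨_, f₀, hf₀, hD', rfl⟩) hlt
  have hz : ∀ q ∈ edgeSupp V D, ∃ z ∈ Metric.ball q η, D' z ≠ 0 := by
    intro q hq
    by_contra! h₀
    obtain ⟨⟨c, hc⟩, hball⟩ := hη q hq
    refine hosc.not_ge (hc.half_le_osc hf ?_ fun x hx hxq => ?_)
    · have h₁ := h₀ q (Metric.mem_ball_self hη₀)
      have h₂ := lt_of_le_of_ne (hDe q) hq.2.symm
      have h₃ := hDf q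
      omega
    · have h₁ := h₀ x hx
      have h₂ : D x = 0 := by
        by_contra hDx
        exact hxq ((hball x (Metric.ball_subset_ball (by linarith) hx)).2 hDx)
      have h₃ := hDf x
      omega
  choose! z hzball hzD using hz
  refine ncard_le_ncard_of_injOn z (fun q hq => ⟨?_, hzD q hq⟩) (fun q hq q' hq' hzz => ?_) hfin
  · exact ((hη q hq).2 _ (Metric.ball_subset_ball (by linarith) (hzball q hq))).1
  · refine (((hη q hq).2 q' ?_).2 hq'.2).symm
    have h₁ := hzball q hq
    have h₂ := hzball q' hq'
    rw [← hzz] at h₂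
    rw [Metric.mem_ball] at h₁ h₂ ⊢
    have := dist_triangle_left q' q (z q)
    linarith

theorem edgeSupp_subset_image {V : Set G} {D D' : G → ℤ} {h : G ≃ₜ G} (hV : ∀ v ∈ V, h v = v)
    (hD : ∀ x, D' (h x) = D x) : edgeSupp V D' ⊆ h '' edgeSupp V D := by
  rintro y ⟨hyV, hy⟩
  obtain ⟨x, rfl⟩ := h.surjective y
  exact ⟨x, ⟨fun hx => hyV (by rwa [hV x hx]), by rwa [← hD]⟩, rfl⟩

theorem linEquiv_of_tangentSlope_eq {V : Set G} (hV : IsGraphModel V) {D₀ D₁ D₂ : G → ℤ}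
    {f₁ f₂ : G → ℝ} (hf₁ : IsRational f₁) (hf₂ : IsRational f₂)
    (h₁ : ∀ x, D₁ x = D₀ x + ordAt f₁ x) (h₂ : ∀ x, D₂ x = D₀ x + ordAt f₂ x)
    (hslope : ∀ v ∈ V, ∀ ζ : TangentDir v, tangentSlope f₁ ζ = tangentSlope f₂ ζ) :
    LinEquiv D₁ D₂ := by
  refine ⟨_, hf₂.sub hf₁, fun x => ?_⟩
  by_cases hx : x ∈ V
  · have h₀ : ordAt (fun y => f₂ y - f₁ y) x = 0 := ordAt_eq_zero fun ζ => by
      rw [hf₂.tangentSlope_sub hf₁, hslope x hx, sub_self]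
    have h₃ : ordAt f₁ x = ordAt f₂ x := finsum_congr (hslope x hx)
    rw [h₁, h₂, h₀, h₃, add_zero]
  · obtain ⟨c, r, h, -⟩ := hV.exists_chart hx Filter.univ_mem
    rw [h.ordAt_sub hf₂ hf₁, h₁, h₂]
    ring

theorem tangentSlope_add_tent {f : G → ℝ} (hf : IsRational f) {p x : G} {δ : ℝ}
    (ht : IsRational (tent p δ)) (hx : δ < dist p x) (ζ : TangentDir x) :
    tangentSlope (fun y => f y + tent p δ y) ζ = tangentSlope f ζ := by
  rw [hf.tangentSlope_add ht, tangentSlope_tent_of_lt_dist hx, add_zero]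

theorem ordAt_add_tent {V : Set G} (hV : IsGraphModel V) {f : G → ℝ} (hf : IsRational f) {p : G}
    {δ : ℝ} (ht : IsRational (tent p δ)) (hpV : ∀ v ∈ V, δ < dist p v) (x : G) :
    ordAt (fun y => f y + tent p δ y) x = ordAt f x + ordAt (tent p δ) x := by
  by_cases hx : x ∈ V
  · rw [ordAt_eq_zero (tangentSlope_tent_of_lt_dist (hpV x hx)), add_zero]
    exact finsum_congr fun ζ => tangentSlope_add_tent hf ht (hpV x hx) ζ
  · obtain ⟨c, r, h, -⟩ := hV.exists_chart hx Filter.univ_mem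
    exact h.ordAt_add hf ht

/-- If two chips can be fired symmetrically off a point, this increases the number of points
in the edges carrying chips, so the divisor is not generic. -/
theorem Generic.eq_one_of_mem_edgeSupp [CompactSpace G] {V : Set G} (hV : IsGraphModel V)
    {D₀ D : G → ℤ} (hgen : Generic V D₀ D) {p : G} (hp : p ∈ edgeSupp V D) : D p = 1 := by
  obtain ⟨⟨hfin, heff, f₀, hf₀, hDf₀⟩, ε, hε, hcell⟩ := hgen
  have : Nonempty G := ⟨p⟩
  have hp0 := lt_of_le_of_ne (heff p) hp.2.symm
  by_contra hp1
  obtain ⟨c, r, hc, hball⟩ := hfin.exists_chart hV hp.1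
  obtain ⟨δ, hδ, hδlt⟩ := exists_between (lt_min hc.pos hε)
  obtain ⟨hδr, hδε⟩ := lt_min_iff.1 hδlt
  have ht := hc.isRational_tent hδ hδr
  have hδ' : |δ| < r := by rwa [abs_of_pos hδ]
  have hδn : |-δ| < r := by rwa [abs_neg]
  have hpV : ∀ v ∈ V, δ < dist p v := fun v hv =>
    hδr.trans_le (not_lt.1 fun h => (hball v (by rwa [Metric.mem_ball, dist_comm])).1 hv)
  have hne : ∀ s : ℝ, |s| < r → s ≠ 0 → c s ≠ p := by
    intro s hs hs0 h
    have := hc.dist_eq hs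
    rw [h, dist_self] at this
    exact hs0 (abs_eq_zero.1 this.symm)
  have hne₁ := hne δ hδ' hδ.ne'
  have hne₂ := hne (-δ) hδn (neg_ne_zero.2 hδ.ne')
  have hne₃ : c δ ≠ c (-δ) := by
    intro h
    have h' := hc.isometricOn δ (abs_lt.1 hδ') (-δ) (abs_lt.1 hδn)
    rw [h, dist_self, sub_neg_eq_add, abs_of_pos (by linarith)] at h'
    linarith
  have hD₁ : D (c δ) = 0 := by
    by_contra h
    exact hne₁ ((hball _ (hc.mem_ball hδ')).2 h)
  have hD₂ : D (c (-δ)) = 0 := by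
    by_contra h
    exact hne₂ ((hball _ (hc.mem_ball hδn)).2 h)
  have ho₀ := hc.ordAt_tent_apex hδ
  have ho₁ := hc.ordAt_tent_foot hδ hδr
  have ho₂ : ordAt (tent p δ) (c (-δ)) = 1 := hc.reverse.ordAt_tent_foot hδ hδr
  have ho₃ := fun x => hc.ordAt_tent_of_ne hδ hδr (x := x)
  set D' : G → ℤ := fun x => D x + ordAt (tent p δ) x with hD'
  have hfin' : FinSupp D' := by
    refine ((hfin.insert (c (-δ))).insert (c δ)).subset fun x hx => ?_
    by_contra hx'
    simp only [mem_insert_iff, not_or, mem_support, not_not] at hx'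
    refine hx ?_
    have : x ≠ p := by
      rintro rfl
      exact hp0.ne' hx'.2.2
    rw [hD']
    simp only [hx'.2.2, ho₃ x this hx'.1 hx'.2.1, add_zero]
  have heff' : Effective D' := by
    intro x
    rw [hD']
    by_cases h₀ : x = p
    · subst h₀
      simp only [ho₀]
      omega
    have := heff x
    by_cases h₁ : x = c δ
    · subst h₁
      simp only [ho₁]
      omega
    by_cases h₂ : x = c (-δ)
    · subst h₂
      simp only [ho₂]
      omega
    simpa only [ho₃ x h₀ h₁ h₂, add_zero]
  have hLE' : LinEquiv D₀ D' := ⟨_, hf₀.add ht, fun x => by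
    rw [ordAt_add_tent hV hf₀ ht hpV, hD', ← add_assoc, ← hDf₀]⟩
  have hlin : linDist D D' < ε :=
    ((linDist_le ht fun x => rfl).trans (osc_tent_le p hδ.le)).trans_lt hδε
  obtain ⟨η, hη, hcard⟩ := ncard_edgeSupp_le_of_linDist_lt hV hfin' heff'
  obtain ⟨D'', ⟨-, ⟨h, hhV, -, hhD⟩, f₁, f₂, hf₁, hf₂, hDf₁, hDf₂, hslope⟩, hlt⟩ :=
    hcell D' ⟨hfin', heff', hLE'⟩ hlin η hη
  have hLE : LinEquiv D' D'' := by
    refine linEquiv_of_tangentSlope_eq hV (D₀ := D₀) (hf₁.add ht) hf₂ (fun x => ?_) hDf₂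
      fun v hv ζ => by rw [tangentSlope_add_tent hf₁ ht (hpV v hv), hslope v hv]
    rw [ordAt_add_tent hV hf₁ ht hpV, hD', ← add_assoc, ← hDf₁]
  have hS : (edgeSupp V D).Finite := hfin.subset fun x hx => hx.2
  have hS' : (edgeSupp V D').Finite := hfin'.subset fun x hx => hx.2
  have himg := edgeSupp_subset_image hhV hhD
  have hle := (hcard D'' hLE ((hS.image h).subset himg) hlt).trans
    ((ncard_le_ncard himg (hS.image h)).trans (ncard_image_le hS))
  have hsub : insert (c δ) (insert (c (-δ)) (edgeSupp V D \ {p})) ⊆ edgeSupp V D' := by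
    rintro x (rfl | rfl | ⟨⟨hxV, hxD⟩, hxp⟩)
    · exact ⟨(hball _ (hc.mem_ball hδ')).1, by simp only [hD', hD₁, ho₁]; norm_num⟩
    · exact ⟨(hball _ (hc.mem_ball hδn)).1, by simp only [hD', hD₂, ho₂]; norm_num⟩
    · refine ⟨hxV, ?_⟩
      rw [hD']
      simp only
      rwa [ho₃ x hxp (fun h => hxD (h ▸ hD₁)) (fun h => hxD (h ▸ hD₂)), add_zero]
  have hcard' := ncard_le_ncard hsub hS'
  rw [ncard_insert_of_notMem _ ((hS.sdiff).insert _), ncard_insert_of_notMem _ hS.sdiff] at hcard'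
  · have := ncard_sdiff_singleton_add_one hp hS
    omega
  · exact fun h => h.1.2 hD₂
  · rintro (h | h)
    · exact hne₃ h
    · exact h.1.2 hD₁

/-- for a generic divisor `D ∈ |D₀|` on a connected metric graph, with
`C_1, …, C_n` the connected components of `Γ ∖ supp(D_E)`,
`dim Δ_D = deg D - g(Γ) + Σ_i (g(C_i) - deg (D|_{C_i}))`. -/
theorem dim_deg_formula (hG : IsMetricGraph G) (hconn : ConnectedSpace G)
    (V : Set G) (hV : IsGraphModel V) (hVl : LoopFree V)
    (D₀ : G → ℤ) (hD₀ : FinSupp D₀) (hD₀e : Effective D₀)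
    (D : G → ℤ) (hD : D ∈ LinSys D₀) (hgen : Generic V D₀ D)
    (g : ℤ) (hg : HasGenusOpen (Set.univ : Set G) g)
    (gen : Set G → ℤ) (hgenC : ∀ C ∈ compsOf (edgeSupp V D)ᶜ, HasGenusOpen C (gen C)) :
    cellDim V D = deg D - g + ∑ᶠ C ∈ compsOf (edgeSupp V D)ᶜ, (gen C - degOn C D) := by
  have := hG.1
  have := hconn
  have hval : ∃ val : G → ℕ, ∀ x, HasValence x (val x) :=
    Classical.skolem.1 fun x => hG.2.2 x
  obtain ⟨val, hval⟩ := hval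
  have hS : (edgeSupp V D).Finite := hD.1.subset fun x hx => hx.2
  have hSV : Disjoint (edgeSupp V D) V := disjoint_left.2 fun x hx => hx.1
  have hfin := hV.finite_compsOf_compl hval hS
  have hone : ∑ᶠ x ∈ edgeSupp V D, D x = (edgeSupp V D).ncard := by
    rw [ncard_eq_finsum_mem hS]
    exact finsum_mem_congr rfl fun x hx => hgen.eq_one_of_mem_edgeSupp hV hx
  have hgenus := genus_eq_sum_of_cut hV hval hS hSV hg hgenC
  have hdeg := deg_eq_add_sum_degOn hD.1 hS hfin
  rw [finsum_mem_sub_distrib _ _ hfin, ← ncard_eq_finsum_mem hfin] at hgenus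
  rw [finsum_mem_sub_distrib _ _ hfin, cellDim]
  linarith

end TropGraph
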